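/- arXiv:2411.09004 — 11 statements merged into one kernel-verified Lean document; each statement's English description precedes it below -/
import Mathlib

section
/- (Invariance of the G-balanced varieties, Arora–Cohen–Hazan.) Let E : M_d → ℝ be C¹ and let 𝐖 : I → M_d^N be a differentiable solution on an interval I of the DLN gradient flow Ẇ_p = −(W_N⋯W_{p+1})ᵀ E'(W) (W_{p−1}⋯W_1)ᵀ, p = 1,…,N, where W = W_N⋯W_1. Then for each p ∈ {1,…,N−1} one has Ẇ_p W_pᵀ = W_{p+1}ᵀ Ẇ_{p+1} along the solution, so that the matrix G_p(t) = W_{p+1}(t)ᵀ W_{p+1}(t) − W_p(t) W_p(t)ᵀ is constant in t. In particular, if 𝐖(t₀) is balanced for some t₀ ∈ I, then 𝐖(t) is balanced for all t ∈ I. -/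
open Matrix BigOperators

attribute [local instance] Matrix.normedAddCommGroup Matrix.normedSpace

noncomputable def mpow {d : ℕ} (P : Matrix (Fin d) (Fin d) ℝ) (s : ℝ) :
    Matrix (Fin d) (Fin d) ℝ :=
  if h : P.IsHermitian then
    (h.eigenvectorUnitary : Matrix (Fin d) (Fin d) ℝ) *
      Matrix.diagonal (fun i => (h.eigenvalues i) ^ s) *
      star (h.eigenvectorUnitary : Matrix (Fin d) (Fin d) ℝ)
  else 0

def Bprod {d : ℕ} (W : ℕ → Matrix (Fin d) (Fin d) ℝ) (p : ℕ) : Matrix (Fin d) (Fin d) ℝ :=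
  ((List.range p).map (fun i => W (p - i))).prod

def Aprod {d : ℕ} (W : ℕ → Matrix (Fin d) (Fin d) ℝ) (N p : ℕ) : Matrix (Fin d) (Fin d) ℝ :=
  ((List.range (N + 1 - p)).map (fun i => W (N - i))).prod

def BalancedTuple {d : ℕ} (N : ℕ) (W : ℕ → Matrix (Fin d) (Fin d) ℝ) : Prop :=
  ∀ p, 1 ≤ p → p < N → (W (p+1))ᵀ * W (p+1) = W p * (W p)ᵀ

noncomputable def frobCLM {d : ℕ} (G : Matrix (Fin d) (Fin d) ℝ) :
    Matrix (Fin d) (Fin d) ℝ →L[ℝ] ℝ :=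
  LinearMap.toContinuousLinearMap
    { toFun := fun Z => (Gᵀ * Z).trace
      map_add' := fun x y => by simp [Matrix.mul_add]
      map_smul' := fun c x => by simp [Matrix.mul_smul] }


theorem Bprod_succ {d : ℕ} (W : ℕ → Matrix (Fin d) (Fin d) ℝ) (p : ℕ) :
    Bprod W (p + 1) = W (p + 1) * Bprod W p := by
  simp [Bprod, List.range_succ_eq_map, Function.comp_def]

theorem Aprod_eq_mul {d : ℕ} (W : ℕ → Matrix (Fin d) (Fin d) ℝ) {N p : ℕ} (h : p ≤ N) :
    Aprod W N p = Aprod W N (p + 1) * W p := by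
  obtain ⟨k, rfl⟩ := Nat.exists_eq_add_of_le h
  have h₁ : p + k + 1 - p = k + 1 := by omega
  have h₂ : p + k + 1 - (p + 1) = k := by omega
  simp [Aprod, h₁, h₂, List.range_succ]

theorem HasDerivAt.matrix_transpose {m n : Type*} [Fintype m] [Fintype n]
    {A : ℝ → Matrix m n ℝ} {A' : Matrix m n ℝ} {t : ℝ} (hA : HasDerivAt A A' t) :
    HasDerivAt (fun s => (A s)ᵀ) A'ᵀ t :=
  hasDerivAt_pi.2 fun i => hasDerivAt_pi.2 fun j => hasDerivAt_pi.1 (hasDerivAt_pi.1 hA j) i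

theorem HasDerivAt.matrix_mul {l m n : Type*} [Fintype l] [Fintype m] [Fintype n]
    {A : ℝ → Matrix l m ℝ} {B : ℝ → Matrix m n ℝ} {A' : Matrix l m ℝ} {B' : Matrix m n ℝ}
    {t : ℝ} (hA : HasDerivAt A A' t) (hB : HasDerivAt B B' t) :
    HasDerivAt (fun s => A s * B s) (A' * B t + A t * B') t := by
  refine hasDerivAt_pi.2 fun i => hasDerivAt_pi.2 fun j => ?_
  simp only [Matrix.add_apply, Matrix.mul_apply, ← Finset.sum_add_distrib]
  exact HasDerivAt.fun_sum fun k _ =>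
    (hasDerivAt_pi.1 (hasDerivAt_pi.1 hA i) k).mul (hasDerivAt_pi.1 (hasDerivAt_pi.1 hB k) j)

/-- If `U' Uᵀ = Vᵀ V'` along two matrix curves, then `Vᵀ V - U Uᵀ` has zero derivative. -/
theorem hasDerivAt_gram_sub_gram_zero {m n k : Type*} [Fintype m] [Fintype n] [Fintype k]
    {U : ℝ → Matrix m n ℝ} {V : ℝ → Matrix k m ℝ} {U' : Matrix m n ℝ} {V' : Matrix k m ℝ}
    {t : ℝ} (hU : HasDerivAt U U' t) (hV : HasDerivAt V V' t)
    (h : U' * (U t)ᵀ = (V t)ᵀ * V') :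
    HasDerivAt (fun s => (V s)ᵀ * V s - U s * (U s)ᵀ) 0 t := by
  have h' : V'ᵀ * V t = U t * U'ᵀ := by
    simpa [Matrix.transpose_mul] using (congrArg Matrix.transpose h).symm
  refine ((hV.matrix_transpose.matrix_mul hV).sub (hU.matrix_mul hU.matrix_transpose)).congr_deriv ?_
  rw [h, h', add_comm, sub_self]

/-- **Arora–Cohen–Hazan: invariance of the G-balanced varieties.**
Along any solution of the DLN gradient flow
`Ẇ_p = −(W_N⋯W_{p+1})ᵀ E'(W) (W_{p−1}⋯W_1)ᵀ` one has
`Ẇ_p W_pᵀ = W_{p+1}ᵀ Ẇ_{p+1}`, the matrices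
`G_p = W_{p+1}ᵀW_{p+1} − W_pW_pᵀ` are constant in time, and balancedness at one
time propagates to all times.  `E` is `C¹` with Euclidean (Frobenius) gradient `G`. -/
theorem dln_balanced_invariant {d N : ℕ} (hN : 1 ≤ N)
    (E : Matrix (Fin d) (Fin d) ℝ → ℝ)
    (G : Matrix (Fin d) (Fin d) ℝ → Matrix (Fin d) (Fin d) ℝ)
    (hE : ∀ X, HasFDerivAt E (frobCLM (G X)) X) (hG : Continuous G)
    (I : Set ℝ) (hI : Convex ℝ I)
    (W : ℕ → ℝ → Matrix (Fin d) (Fin d) ℝ)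
    (hflow : ∀ p, 1 ≤ p → p ≤ N → ∀ t ∈ I,
      HasDerivAt (W p)
        (-((Aprod (fun q => W q t) N (p + 1))ᵀ * G (Bprod (fun q => W q t) N) *
            (Bprod (fun q => W q t) (p - 1))ᵀ)) t) :
    (∀ p, 1 ≤ p → p < N → ∀ t ∈ I,
        (-((Aprod (fun q => W q t) N (p + 1))ᵀ * G (Bprod (fun q => W q t) N) *
            (Bprod (fun q => W q t) (p - 1))ᵀ)) * (W p t)ᵀ
          = (W (p + 1) t)ᵀ *
            (-((Aprod (fun q => W q t) N (p + 2))ᵀ * G (Bprod (fun q => W q t) N) *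
                (Bprod (fun q => W q t) p)ᵀ)))
    ∧ (∀ p, 1 ≤ p → p < N → ∀ s ∈ I, ∀ t ∈ I,
        (W (p + 1) s)ᵀ * W (p + 1) s - W p s * (W p s)ᵀ
          = (W (p + 1) t)ᵀ * W (p + 1) t - W p t * (W p t)ᵀ)
    ∧ (∀ t₀ ∈ I, BalancedTuple N (fun q => W q t₀) →
        ∀ t ∈ I, BalancedTuple N (fun q => W q t)) := by
  have hsymm : ∀ p, 1 ≤ p → p < N → ∀ t ∈ I,
      (-((Aprod (fun q => W q t) N (p + 1))ᵀ * G (Bprod (fun q => W q t) N) *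
          (Bprod (fun q => W q t) (p - 1))ᵀ)) * (W p t)ᵀ
        = (W (p + 1) t)ᵀ *
          (-((Aprod (fun q => W q t) N (p + 2))ᵀ * G (Bprod (fun q => W q t) N) *
              (Bprod (fun q => W q t) p)ᵀ)) := by
    intro p hp hpN t _
    obtain ⟨k, rfl⟩ := Nat.exists_eq_add_of_le' hp
    rw [Nat.add_sub_cancel, Bprod_succ, Aprod_eq_mul _ hpN]
    simp only [Matrix.transpose_mul, Matrix.mul_assoc, Matrix.neg_mul, Matrix.mul_neg]
  have hconst : ∀ p, 1 ≤ p → p < N → ∀ s ∈ I, ∀ t ∈ I,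
      (W (p + 1) s)ᵀ * W (p + 1) s - W p s * (W p s)ᵀ
        = (W (p + 1) t)ᵀ * W (p + 1) t - W p t * (W p t)ᵀ := by
    intro p hp hpN s hs t ht
    have hderiv : ∀ r ∈ I, HasDerivAt
        (fun r => (W (p + 1) r)ᵀ * W (p + 1) r - W p r * (W p r)ᵀ) 0 r := fun r hr =>
      hasDerivAt_gram_sub_gram_zero (hflow p hp hpN.le r hr)
        (hflow (p + 1) (by omega) hpN r hr) (hsymm p hp hpN r hr)
    have hnorm := hI.norm_image_sub_le_of_norm_hasDerivWithin_le (C := 0)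
      (fun r hr => (hderiv r hr).hasDerivWithinAt) (fun _ _ => norm_zero.le) ht hs
    rw [zero_mul] at hnorm
    exact sub_eq_zero.1 (norm_le_zero_iff.1 hnorm)
  refine ⟨hsymm, hconst, fun t₀ ht₀ hbal t ht p hp hpN => ?_⟩
  exact sub_eq_zero.1 ((hconst p hp hpN t ht t₀ ht₀).trans (sub_eq_zero.2 (hbal p hp hpN)))
end

section
/- Let 𝐖 = (W_N,…,W_1) ∈ M_d^N be balanced and let W = W_N⋯W_1 be its end-to-end matrix. Then WᵀW = (W_1ᵀ W_1)^N and WWᵀ = (W_N W_Nᵀ)^N. Consequently, by uniqueness of positive semidefinite N-th roots of positive semidefinite matrices, W_1ᵀ W_1 = (WᵀW)^{1/N} and W_N W_Nᵀ = (WWᵀ)^{1/N}. -/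
open Matrix BigOperators

attribute [local instance] Matrix.normedAddCommGroup Matrix.normedSpace

theorem Bprod_one {d : ℕ} (W : ℕ → Matrix (Fin d) (Fin d) ℝ) : Bprod W 1 = W 1 := by
  simp [Bprod]

theorem mul_pow_mul_eq_pow_succ {M : Type*} [Monoid M] (a b : M) (k : ℕ) :
    a * (b * a) ^ k * b = (a * b) ^ (k + 1) := by
  induction k with
  | zero => simp
  | succ k ih => rw [pow_succ (a * b), ← ih, pow_succ]; simp only [mul_assoc]

theorem BalancedTuple.Bprod_mul_transpose {d N : ℕ} {W : ℕ → Matrix (Fin d) (Fin d) ℝ}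
    (hbal : BalancedTuple N W) {p : ℕ} (hp : 1 ≤ p) (hpN : p ≤ N) :
    Bprod W p * (Bprod W p)ᵀ = (W p * (W p)ᵀ) ^ p := by
  induction p, hp using Nat.le_induction with
  | base => simp [Bprod_one]
  | succ p hp ih =>
    rw [← mul_pow_mul_eq_pow_succ, hbal p hp hpN, ← ih (by lia), Bprod_succ, transpose_mul]
    simp only [mul_assoc]

theorem BalancedTuple.transpose_Bprod_mul_pow_mul {d N : ℕ}
    {W : ℕ → Matrix (Fin d) (Fin d) ℝ} (hbal : BalancedTuple N W) {p : ℕ} (hp : 1 ≤ p)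
    (hpN : p ≤ N) (k : ℕ) :
    (Bprod W p)ᵀ * (W p * (W p)ᵀ) ^ k * Bprod W p = ((W 1)ᵀ * W 1) ^ (p + k) := by
  induction p, hp using Nat.le_induction generalizing k with
  | base => rw [Bprod_one, mul_pow_mul_eq_pow_succ, add_comm]
  | succ p hp ih =>
    rw [add_assoc, add_comm 1 k, ← ih (by lia), ← hbal p hp hpN, ← mul_pow_mul_eq_pow_succ, Bprod_succ,
      transpose_mul]
    simp only [mul_assoc]

theorem mpow_eq_cfc {d : ℕ} {P : Matrix (Fin d) (Fin d) ℝ} (hP : P.IsHermitian) (s : ℝ) :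
    mpow P s = cfc (fun x : ℝ => x ^ s) P := by
  rw [mpow, dif_pos hP, hP.cfc_eq, Matrix.IsHermitian.cfc, Unitary.conjStarAlgAut_apply]
  rfl

theorem mpow_pow_one_div {d N : ℕ} (hN : 1 ≤ N) {P : Matrix (Fin d) (Fin d) ℝ}
    (hP : P.PosSemidef) : mpow (P ^ N) (1 / N) = P := by
  have hsa : IsSelfAdjoint P := hP.isHermitian
  rw [mpow_eq_cfc (hP.isHermitian.pow N),
    ← cfc_comp_pow (fun x : ℝ => x ^ (1 / N : ℝ)) N P
      ((Matrix.finite_real_spectrum.image _).continuousOn _)]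
  refine (cfc_congr fun x hx => ?_).trans (cfc_id ℝ P)
  rw [hP.isHermitian.spectrum_real_eq_range_eigenvalues] at hx
  obtain ⟨i, rfl⟩ := hx
  simpa using Real.pow_rpow_inv_natCast (hP.eigenvalues_nonneg i) (by lia : N ≠ 0)

/-- For a balanced tuple with end-to-end matrix `W = W_N⋯W_1`:
`WᵀW = (W_1ᵀW_1)^N`, `WWᵀ = (W_N W_Nᵀ)^N`, and hence (uniqueness of psd `N`-th
roots) `W_1ᵀW_1 = (WᵀW)^{1/N}` and `W_N W_Nᵀ = (WWᵀ)^{1/N}`, fractional powers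
being taken via the spectral decomposition. -/
theorem dln_balanced_roots {d N : ℕ} (hN : 1 ≤ N)
    (W : ℕ → Matrix (Fin d) (Fin d) ℝ) (hbal : BalancedTuple N W) :
    (Bprod W N)ᵀ * Bprod W N = ((W 1)ᵀ * W 1) ^ N
    ∧ Bprod W N * (Bprod W N)ᵀ = (W N * (W N)ᵀ) ^ N
    ∧ (W 1)ᵀ * W 1 = mpow ((Bprod W N)ᵀ * Bprod W N) (1 / N)
    ∧ W N * (W N)ᵀ = mpow (Bprod W N * (Bprod W N)ᵀ) (1 / N) := by
  have h₁ : (Bprod W N)ᵀ * Bprod W N = ((W 1)ᵀ * W 1) ^ N := by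
    simpa using hbal.transpose_Bprod_mul_pow_mul hN le_rfl 0
  have h₂ := hbal.Bprod_mul_transpose hN le_rfl
  refine ⟨h₁, h₂, ?_, ?_⟩
  · rw [h₁, mpow_pow_one_div hN]
    simpa using posSemidef_conjTranspose_mul_self (W 1)
  · rw [h₂, mpow_pow_one_div hN]
    simpa using posSemidef_self_mul_conjTranspose (W N)
end

section
/- Let 𝐖 = (W_N,…,W_1) ∈ M_d^N be balanced with end-to-end matrix W = W_N⋯W_1. Then for every p ∈ {1,…,N}, the matrix W_pᵀ W_p has the same characteristic polynomial as W_1ᵀ W_1; in particular all the matrices W_p have identical singular values, and (W_pᵀ W_p)^N has the same characteristic polynomial as WᵀW, i.e. the singular values of each W_p are the N-th roots of the singular values of W. -/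
open Matrix BigOperators

attribute [local instance] Matrix.normedAddCommGroup Matrix.normedSpace

theorem Matrix.mul_pow_mul_comm {n R : Type*} [Fintype n] [DecidableEq n] [Semiring R]
    (A B : Matrix n n R) (k : ℕ) : A * (B * A) ^ k = (A * B) ^ k * A :=
  ((show SemiconjBy A (B * A) (A * B) from (Matrix.mul_assoc A B A).symm).pow_right k).eq

theorem Matrix.charpoly_mul_pow_comm {n R : Type*} [Fintype n] [DecidableEq n] [CommRing R]
    (A B : Matrix n n R) (k : ℕ) : ((A * B) ^ k).charpoly = ((B * A) ^ k).charpoly := by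
  cases k with
  | zero => simp
  | succ k =>
    rw [pow_succ, ← Matrix.mul_assoc, ← Matrix.mul_pow_mul_comm, Matrix.mul_assoc,
      Matrix.charpoly_mul_comm, Matrix.mul_assoc, ← pow_succ]

theorem BalancedTuple.charpoly_gram_pow {d N : ℕ} {W : ℕ → Matrix (Fin d) (Fin d) ℝ}
    (hbal : BalancedTuple N W) (k p : ℕ) (hp : 1 ≤ p) (hpN : p ≤ N) :
    (((W p)ᵀ * W p) ^ k).charpoly = (((W 1)ᵀ * W 1) ^ k).charpoly := by
  induction p, hp using Nat.le_induction with
  | base => rfl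
  | succ p hp ih => rw [hbal p hp hpN, Matrix.charpoly_mul_pow_comm, ih (by omega)]

theorem BalancedTuple.Bprod_transpose_mul_gram_pow_mul_Bprod {d N : ℕ}
    {W : ℕ → Matrix (Fin d) (Fin d) ℝ} (hbal : BalancedTuple N W) (p k : ℕ) (hp : p < N) :
    (Bprod W p)ᵀ * ((W (p + 1))ᵀ * W (p + 1)) ^ k * Bprod W p = ((W 1)ᵀ * W 1) ^ (p + k) := by
  induction p generalizing k with
  | zero => simp [Bprod]
  | succ p ih =>
    rw [hbal (p + 1) (by omega) hp, show p + 1 + k = p + (k + 1) by omega,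
      ← ih (k + 1) (by omega), Bprod_succ, Matrix.transpose_mul, pow_succ]
    simp only [Matrix.mul_assoc]
    rw [← Matrix.mul_assoc (W (p + 1))ᵀ, Matrix.mul_pow_mul_comm]
    simp only [Matrix.mul_assoc]

theorem BalancedTuple.Bprod_transpose_mul_Bprod {d N : ℕ} (hN : 1 ≤ N)
    {W : ℕ → Matrix (Fin d) (Fin d) ℝ} (hbal : BalancedTuple N W) :
    (Bprod W N)ᵀ * Bprod W N = ((W 1)ᵀ * W 1) ^ N := by
  obtain ⟨p, rfl⟩ := Nat.exists_eq_add_of_le' hN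
  rw [← hbal.Bprod_transpose_mul_gram_pow_mul_Bprod p 1 (by omega), Bprod_succ,
    Matrix.transpose_mul, pow_one]
  simp only [Matrix.mul_assoc]

/-- For a balanced tuple, all layer matrices have identical
singular values: `W_pᵀW_p` has the same characteristic polynomial as `W_1ᵀW_1`,
and `(W_pᵀW_p)^N` has the same characteristic polynomial as `WᵀW` for the
end-to-end matrix `W = W_N⋯W_1`. -/
theorem dln_balanced_singular_values {d N : ℕ} (hN : 1 ≤ N)
    (W : ℕ → Matrix (Fin d) (Fin d) ℝ) (hbal : BalancedTuple N W) :
    ∀ p, 1 ≤ p → p ≤ N →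
      ((W p)ᵀ * W p).charpoly = ((W 1)ᵀ * W 1).charpoly
      ∧ (((W p)ᵀ * W p) ^ N).charpoly = ((Bprod W N)ᵀ * Bprod W N).charpoly := by
  intro p hp hpN
  refine ⟨?_, ?_⟩
  · simpa using hbal.charpoly_gram_pow 1 p hp hpN
  · rw [hbal.Bprod_transpose_mul_Bprod hN, hbal.charpoly_gram_pow N p hp hpN]
end

section
/- Let 𝐖 = (W_N,…,W_1) ∈ M_d^N be balanced with end-to-end matrix W = W_N⋯W_1. Then for every p ∈ {0,…,N−1}, the partial product A_{p+1} = W_N⋯W_{p+1} satisfies A_{p+1} A_{p+1}ᵀ = (WWᵀ)^{(N−p)/N}, and for every p ∈ {1,…,N}, the partial product B_p = W_p⋯W_1 satisfies B_pᵀ B_p = (WᵀW)^{p/N}, where the fractional powers of positive semidefinite matrices are defined through the spectral decomposition. -/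
open Matrix BigOperators

attribute [local instance] Matrix.normedAddCommGroup Matrix.normedSpace

theorem Bprod_zero {d : ℕ} (W : ℕ → Matrix (Fin d) (Fin d) ℝ) : Bprod W 0 = 1 := by
  simp [Bprod]

/-- Reversing the order of the factors and transposing each of them turns `Aprod` into `Bprod`. -/
theorem Aprod_eq_transpose_Bprod {d : ℕ} (W : ℕ → Matrix (Fin d) (Fin d) ℝ) (N p : ℕ) :
    Aprod W N p = (Bprod (fun i => (W (N + 1 - i))ᵀ) (N + 1 - p))ᵀ := by
  unfold Aprod
  induction N + 1 - p with
  | zero => simp [Bprod_zero]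
  | succ k ih => simp [Bprod_succ, List.range_succ, ih]

theorem BalancedTuple.reverse_transpose {d N : ℕ} {W : ℕ → Matrix (Fin d) (Fin d) ℝ}
    (h : BalancedTuple N W) : BalancedTuple N (fun i => (W (N + 1 - i))ᵀ) := by
  intro p hp hpN
  have := h (N - p) (by omega) (by omega)
  rw [show N - p + 1 = N + 1 - p by omega] at this
  simp [this]

theorem BalancedTuple.gram_mul_Bprod {d N : ℕ} {W : ℕ → Matrix (Fin d) (Fin d) ℝ}
    (h : BalancedTuple N W) {p : ℕ} (hp : p < N) :
    (W (p + 1))ᵀ * W (p + 1) * Bprod W p = Bprod W p * ((W 1)ᵀ * W 1) := by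
  induction p with
  | zero => simp [Bprod_zero]
  | succ p ih =>
    rw [h (p + 1) (by omega) hp, Bprod_succ, Matrix.mul_assoc (W (p + 1)) (Bprod W p),
      ← ih (by omega)]
    simp only [Matrix.mul_assoc]

theorem BalancedTuple.transpose_Bprod_mul_Bprod {d N : ℕ} {W : ℕ → Matrix (Fin d) (Fin d) ℝ}
    (h : BalancedTuple N W) {p : ℕ} (hp : p ≤ N) :
    (Bprod W p)ᵀ * Bprod W p = ((W 1)ᵀ * W 1) ^ p := by
  induction p with
  | zero => simp [Bprod_zero]
  | succ p ih =>
    calc (Bprod W (p + 1))ᵀ * Bprod W (p + 1)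
        = (Bprod W p)ᵀ * ((W (p + 1))ᵀ * W (p + 1) * Bprod W p) := by
          simp only [Bprod_succ, Matrix.transpose_mul, Matrix.mul_assoc]
      _ = ((W 1)ᵀ * W 1) ^ (p + 1) := by
          rw [h.gram_mul_Bprod hp, ← Matrix.mul_assoc, ih (by omega), pow_succ]

theorem mpow_pow {d : ℕ} {P : Matrix (Fin d) (Fin d) ℝ} (hP : P.PosSemidef) {N : ℕ}
    (hN : N ≠ 0) (p : ℕ) : mpow (P ^ N) ((p : ℝ) / N) = P ^ p := by
  have hsa : IsSelfAdjoint P := hP.isHermitian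
  rw [mpow_eq_cfc (hP.isHermitian.pow N),
    ← cfc_comp_pow (fun x : ℝ => x ^ ((p : ℝ) / N)) N P
      (Real.continuous_rpow_const (by positivity)).continuousOn hsa,
    ← cfc_pow_id (R := ℝ) P p hsa]
  refine cfc_congr fun x hx => ?_
  rw [hP.isHermitian.spectrum_real_eq_range_eigenvalues] at hx
  obtain ⟨i, rfl⟩ := hx
  have hN' : (N : ℝ) ≠ 0 := by exact_mod_cast hN
  rw [← Real.rpow_natCast_mul (hP.eigenvalues_nonneg i), mul_div_cancel₀ _ hN',
    Real.rpow_natCast]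

theorem BalancedTuple.transpose_Bprod_mul_Bprod_eq_mpow {d N : ℕ}
    {W : ℕ → Matrix (Fin d) (Fin d) ℝ} (h : BalancedTuple N W) (hN : N ≠ 0) {p : ℕ}
    (hp : p ≤ N) :
    (Bprod W p)ᵀ * Bprod W p = mpow ((Bprod W N)ᵀ * Bprod W N) ((p : ℝ) / N) := by
  rw [h.transpose_Bprod_mul_Bprod hp, h.transpose_Bprod_mul_Bprod le_rfl,
    mpow_pow (by simpa using Matrix.posSemidef_conjTranspose_mul_self (W 1)) hN]

/-- For a balanced tuple with end-to-end matrix `W = W_N⋯W_1`,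
the partial products `A_{p+1} = W_N⋯W_{p+1}` and `B_p = W_p⋯W_1` satisfy
`A_{p+1}A_{p+1}ᵀ = (WWᵀ)^{(N−p)/N}` (0 ≤ p ≤ N−1) and
`B_pᵀB_p = (WᵀW)^{p/N}` (1 ≤ p ≤ N), fractional powers via spectral
decomposition. -/
theorem dln_partial_products_power {d N : ℕ} (hN : 1 ≤ N)
    (W : ℕ → Matrix (Fin d) (Fin d) ℝ) (hbal : BalancedTuple N W) :
    (∀ p, p < N →
      Aprod W N (p + 1) * (Aprod W N (p + 1))ᵀ
        = mpow (Bprod W N * (Bprod W N)ᵀ) (((N : ℝ) - p) / N))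
    ∧ (∀ p, 1 ≤ p → p ≤ N →
      (Bprod W p)ᵀ * Bprod W p
        = mpow ((Bprod W N)ᵀ * Bprod W N) ((p : ℝ) / N)) := by
  refine ⟨fun p hp => ?_, fun p _ hp =>
    hbal.transpose_Bprod_mul_Bprod_eq_mpow (by omega) hp⟩
  have hAB : Bprod W N = Aprod W N 1 := by simp [Aprod, Bprod]
  have := hbal.reverse_transpose.transpose_Bprod_mul_Bprod_eq_mpow (by omega) (Nat.sub_le N p)
  rw [Nat.cast_sub hp.le] at this
  simpa [hAB, Aprod_eq_transpose_Bprod] using this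
end

section
/- (Spectral decomposition of the DLN operator.) Let W ∈ M_d have singular value decomposition W = ∑_{j=1}^d σ_j u_j v_jᵀ, where {u_j} and {v_j} are orthonormal bases of ℝ^d and σ_j ≥ 0, and define A_{N,W} : M_d → M_d by A_{N,W}(Z) = ∑_{p=1}^N (WWᵀ)^{(N−p)/N} Z (WᵀW)^{(p−1)/N}. Then for all 1 ≤ k, l ≤ d, A_{N,W}(u_k v_lᵀ) = c_{kl} u_k v_lᵀ with c_{kl} = ∑_{p=1}^N σ_k^{2(N−p)/N} σ_l^{2(p−1)/N}; in particular, c_{kl} = (σ_k² − σ_l²)/(σ_k^{2/N} − σ_l^{2/N}) whenever σ_k ≠ σ_l, and c_{kk} = N σ_k^{2−2/N}. -/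
open Matrix BigOperators

attribute [local instance] Matrix.normedAddCommGroup Matrix.normedSpace

theorem mpow_mulVec_of_eigenvector {d : ℕ} {P : Matrix (Fin d) (Fin d) ℝ} (hP : P.IsHermitian)
    {x : Fin d → ℝ} {a : ℝ} (hx : P *ᵥ x = a • x) (s : ℝ) :
    mpow P s *ᵥ x = a ^ s • x := by
  set Q : Matrix (Fin d) (Fin d) ℝ :=
    (hP.eigenvectorUnitary : Matrix (Fin d) (Fin d) ℝ) with hQ
  have hQQ : star Q * Q = 1 := Unitary.coe_star_mul_self hP.eigenvectorUnitary
  have hQQ' : Q * star Q = 1 := Unitary.coe_mul_star_self hP.eigenvectorUnitary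
  have hspec : P = Q * diagonal hP.eigenvalues * star Q := by
    simpa [Unitary.conjStarAlgAut_apply, Function.comp_def] using hP.spectral_theorem
  have hdiag : diagonal hP.eigenvalues *ᵥ (star Q *ᵥ x) = a • (star Q *ᵥ x) := by
    have h : star Q *ᵥ (P *ᵥ x) = a • (star Q *ᵥ x) := by rw [hx, mulVec_smul]
    rw [← h, mulVec_mulVec, mulVec_mulVec]
    congr 1
    nth_rewrite 2 [hspec]
    rw [← mul_assoc, ← mul_assoc, hQQ, one_mul]
  have hpow : diagonal (fun i => hP.eigenvalues i ^ s) *ᵥ (star Q *ᵥ x)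
      = a ^ s • (star Q *ᵥ x) := by
    ext i
    have hi := congrFun hdiag i
    simp only [mulVec_diagonal, Pi.smul_apply, smul_eq_mul] at hi ⊢
    rcases eq_or_ne ((star Q *ᵥ x) i) 0 with h0 | h0
    · simp [h0]
    · rw [mul_right_cancel₀ h0 hi]
  rw [mpow, dif_pos hP, ← hQ, ← mulVec_mulVec, ← mulVec_mulVec, hpow, mulVec_smul, mulVec_mulVec,
    hQQ', one_mulVec]

theorem mpow_transpose {d : ℕ} (P : Matrix (Fin d) (Fin d) ℝ) (s : ℝ) :
    (mpow P s)ᵀ = mpow P s := by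
  unfold mpow
  split_ifs
  · simp [star_eq_conjTranspose, conjTranspose_eq_transpose_of_trivial, mul_assoc]
  · simp

theorem sum_smul_vecMulVec_mulVec_col {d : ℕ} (U V : Matrix (Fin d) (Fin d) ℝ)
    (hV : Vᵀ * V = 1) (σ : Fin d → ℝ) (k : Fin d) :
    (∑ j, σ j • vecMulVec (fun i => U i j) (fun i => V i j)) *ᵥ (fun i => V i k)
      = σ k • fun i => U i k := by
  have horth : ∀ j, (fun i => V i j) ⬝ᵥ (fun i => V i k) = if j = k then 1 else 0 := fun j => by
    simpa [mul_apply, dotProduct, one_apply] using congrFun (congrFun hV j) k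
  simp only [sum_mulVec, smul_mulVec, vecMulVec_mulVec, horth]
  rw [Finset.sum_eq_single k (fun j _ hj => by simp [hj]) (by simp)]
  simp

theorem gram_mulVec_of_svd {d : ℕ} (U V : Matrix (Fin d) (Fin d) ℝ)
    (hU : Uᵀ * U = 1) (hV : Vᵀ * V = 1) (σ : Fin d → ℝ) {W : Matrix (Fin d) (Fin d) ℝ}
    (hW : W = ∑ j, σ j • vecMulVec (fun i => U i j) (fun i => V i j)) (k : Fin d) :
    (W * Wᵀ) *ᵥ (fun i => U i k) = σ k ^ 2 • fun i => U i k := by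
  have hWt : Wᵀ = ∑ j, σ j • vecMulVec (fun i => V i j) (fun i => U i j) := by
    simp [hW, transpose_sum, transpose_vecMulVec]
  rw [← mulVec_mulVec, hWt, sum_smul_vecMulVec_mulVec_col V U hU, mulVec_smul, hW,
    sum_smul_vecMulVec_mulVec_col U V hV, smul_smul, sq]

theorem sum_rpow_mul_rpow_eq_geom {N : ℕ} (hN : 1 ≤ N) {a b : ℝ} (ha : 0 ≤ a) (hb : 0 ≤ b) :
    (∑ p ∈ Finset.Icc 1 N, a ^ (2 * ((N : ℝ) - p) / N) * b ^ (2 * ((p : ℝ) - 1) / N))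
      = ∑ i ∈ Finset.range N, (b ^ ((2 : ℝ) / N)) ^ i * (a ^ ((2 : ℝ) / N)) ^ (N - 1 - i) := by
  rw [← Finset.Ico_add_one_right_eq_Icc, Finset.sum_Ico_eq_sum_range]
  refine Finset.sum_congr (by simp) fun i hi => ?_
  have hiN : i < N := by simpa using hi
  rw [← Real.rpow_mul_natCast ha, ← Real.rpow_mul_natCast hb, mul_comm]
  have hcast : ((N - 1 - i : ℕ) : ℝ) = N - 1 - i := by
    rw [Nat.cast_sub (by omega), Nat.cast_sub hN, Nat.cast_one]
  rw [hcast]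
  push_cast
  congr 2 <;> ring

theorem sum_rpow_mul_rpow_of_ne {N : ℕ} (hN : 1 ≤ N) {a b : ℝ} (ha : 0 ≤ a) (hb : 0 ≤ b)
    (hab : a ≠ b) :
    (∑ p ∈ Finset.Icc 1 N, a ^ (2 * ((N : ℝ) - p) / N) * b ^ (2 * ((p : ℝ) - 1) / N))
      = (a ^ 2 - b ^ 2) / (a ^ ((2 : ℝ) / N) - b ^ ((2 : ℝ) / N)) := by
  have hN0 : (N : ℝ) ≠ 0 := by positivity
  have hexp : (2 : ℝ) / N ≠ 0 := by positivity
  have hne : a ^ ((2 : ℝ) / N) - b ^ ((2 : ℝ) / N) ≠ 0 :=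
    sub_ne_zero.2 fun h => hab ((Real.rpow_left_inj ha hb hexp).1 h)
  have hpow : ∀ {c : ℝ}, 0 ≤ c → (c ^ ((2 : ℝ) / N)) ^ N = c ^ 2 := fun hc => by
    rw [← Real.rpow_mul_natCast hc, div_mul_cancel₀ _ hN0, Real.rpow_two]
  rw [sum_rpow_mul_rpow_eq_geom hN ha hb, eq_div_iff hne, ← hpow ha, ← hpow hb]
  linear_combination -geom_sum₂_mul (b ^ ((2 : ℝ) / N)) (a ^ ((2 : ℝ) / N)) N

theorem sum_rpow_mul_rpow_self {N : ℕ} (hN : 1 ≤ N) {a : ℝ} (ha : 0 ≤ a) :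
    (∑ p ∈ Finset.Icc 1 N, a ^ (2 * ((N : ℝ) - p) / N) * a ^ (2 * ((p : ℝ) - 1) / N))
      = N * a ^ (2 - (2 : ℝ) / N) := by
  have hN0 : (N : ℝ) ≠ 0 := by positivity
  rw [sum_rpow_mul_rpow_eq_geom hN ha ha, geom_sum₂_self, ← Real.rpow_mul_natCast ha,
    Nat.cast_sub hN, Nat.cast_one]
  congr 2
  field_simp

/-- **spectral decomposition of the DLN operator `A_{N,W}`.**
If `W = ∑_j σ_j u_j v_jᵀ` is an SVD (columns of orthogonal `U`, `V`), then
each rank-one matrix `u_k v_lᵀ` is an eigenvector of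
`Z ↦ ∑_{p=1}^N (WWᵀ)^{(N−p)/N} Z (WᵀW)^{(p−1)/N}` with eigenvalue
`c_{kl} = ∑_{p=1}^N σ_k^{2(N−p)/N} σ_l^{2(p−1)/N}`; moreover
`c_{kl} = (σ_k²−σ_l²)/(σ_k^{2/N}−σ_l^{2/N})` when `σ_k ≠ σ_l`, and
`c_{kk} = N σ_k^{2−2/N}`. -/
theorem dln_operator_spectrum {d N : ℕ} (hN : 1 ≤ N)
    (U V : Matrix (Fin d) (Fin d) ℝ) (σ : Fin d → ℝ)
    (hU : Uᵀ * U = 1) (hV : Vᵀ * V = 1) (hσ : ∀ i, 0 ≤ σ i)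
    (W : Matrix (Fin d) (Fin d) ℝ)
    (hW : W = ∑ j, σ j • Matrix.vecMulVec (fun i => U i j) (fun i => V i j)) :
    ∀ k l : Fin d,
      (∑ p ∈ Finset.Icc 1 N,
          mpow (W * Wᵀ) (((N : ℝ) - p) / N) *
            Matrix.vecMulVec (fun i => U i k) (fun i => V i l) *
            mpow (Wᵀ * W) (((p : ℝ) - 1) / N))
        = (∑ p ∈ Finset.Icc 1 N,
            σ k ^ (2 * ((N : ℝ) - p) / N) * σ l ^ (2 * ((p : ℝ) - 1) / N)) •
            Matrix.vecMulVec (fun i => U i k) (fun i => V i l)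
      ∧ (σ k ≠ σ l →
          (∑ p ∈ Finset.Icc 1 N,
              σ k ^ (2 * ((N : ℝ) - p) / N) * σ l ^ (2 * ((p : ℝ) - 1) / N))
            = (σ k ^ 2 - σ l ^ 2) / (σ k ^ ((2 : ℝ) / N) - σ l ^ ((2 : ℝ) / N)))
      ∧ (∑ p ∈ Finset.Icc 1 N,
            σ k ^ (2 * ((N : ℝ) - p) / N) * σ k ^ (2 * ((p : ℝ) - 1) / N))
          = N * σ k ^ (2 - (2 : ℝ) / N) := by
  intro k l
  refine ⟨?_, sum_rpow_mul_rpow_of_ne hN (hσ k) (hσ l), sum_rpow_mul_rpow_self hN (hσ k)⟩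
  have hWt : Wᵀ = ∑ j, σ j • vecMulVec (fun i => V i j) (fun i => U i j) := by
    simp [hW, transpose_sum, transpose_vecMulVec]
  have hleft := gram_mulVec_of_svd U V hU hV σ hW k
  have hright : (Wᵀ * W) *ᵥ (fun i => V i l) = σ l ^ 2 • fun i => V i l := by
    simpa using gram_mulVec_of_svd V U hV hU σ hWt l
  have hsq : ∀ {c : ℝ}, 0 ≤ c → ∀ t : ℝ, (c ^ 2) ^ (t / N) = c ^ (2 * t / N) := fun hc t => by
    rw [← Real.rpow_natCast, ← Real.rpow_mul hc, Nat.cast_ofNat, mul_div_assoc]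
  have hWW : (W * Wᵀ).IsHermitian := by
    simpa [conjTranspose_eq_transpose_of_trivial] using isHermitian_mul_conjTranspose_self W
  have hWW' : (Wᵀ * W).IsHermitian := by
    simpa [conjTranspose_eq_transpose_of_trivial] using isHermitian_conjTranspose_mul_self W
  rw [Finset.sum_smul]
  refine Finset.sum_congr rfl fun p _ => ?_
  rw [mul_vecMulVec, vecMulVec_mul,
    mpow_mulVec_of_eigenvector hWW hleft, ← mulVec_transpose,
    mpow_transpose, mpow_mulVec_of_eigenvector hWW' hright,
    hsq (hσ k), hsq (hσ l), smul_vecMulVec, vecMulVec_smul, smul_smul]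
end

section
/- For every W ∈ M_d, the linear map A_{N,W} : M_d → M_d, Z ↦ ∑_{p=1}^N (WWᵀ)^{(N−p)/N} Z (WᵀW)^{(p−1)/N}, is self-adjoint and positive semidefinite with respect to the Frobenius inner product: ⟨A_{N,W}(Z₁), Z₂⟩_F = ⟨Z₁, A_{N,W}(Z₂)⟩_F for all Z₁, Z₂ ∈ M_d, and ⟨A_{N,W}(Z), Z⟩_F ≥ 0 for all Z ∈ M_d. If moreover W is invertible, then A_{N,W} is positive definite, hence invertible. -/
open Matrix BigOperators

attribute [local instance] Matrix.normedAddCommGroup Matrix.normedSpace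

/-- The DLN operator `A_{N,W} : Z ↦ ∑_{p=1}^N (WWᵀ)^{(N−p)/N} Z (WᵀW)^{(p−1)/N}`. -/
noncomputable def dlnMap {d : ℕ} (N : ℕ) (W Z : Matrix (Fin d) (Fin d) ℝ) :
    Matrix (Fin d) (Fin d) ℝ :=
  ∑ p ∈ Finset.Icc 1 N,
    mpow (W * Wᵀ) (((N : ℝ) - p) / N) * Z * mpow (Wᵀ * W) (((p : ℝ) - 1) / N)

theorem mpow_posSemidef {d : ℕ} {P : Matrix (Fin d) (Fin d) ℝ} (hP : P.PosSemidef) (s : ℝ) :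
    (mpow P s).PosSemidef := by
  rw [mpow, dif_pos hP.isHermitian]
  exact (PosSemidef.diagonal fun i => Real.rpow_nonneg (hP.eigenvalues_nonneg i) s)
    |>.mul_mul_conjTranspose_same _

theorem mpow_isUnit {d : ℕ} {P : Matrix (Fin d) (Fin d) ℝ} (hP : P.PosDef) (s : ℝ) :
    IsUnit (mpow P s) := by
  rw [mpow, dif_pos hP.isHermitian]
  have hU := Unitary.isUnit_coe (U := hP.isHermitian.eigenvectorUnitary)
  refine (hU.mul ?_).mul hU.star
  rw [Matrix.isUnit_diagonal, Pi.isUnit_iff]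
  exact fun i => (Real.rpow_pos_of_pos (hP.eigenvalues_pos i) s).ne'.isUnit

theorem mul_transpose_self_posSemidef {d : ℕ} (W : Matrix (Fin d) (Fin d) ℝ) :
    (W * Wᵀ).PosSemidef := by
  simpa using posSemidef_self_mul_conjTranspose W

theorem transpose_mul_self_posSemidef {d : ℕ} (W : Matrix (Fin d) (Fin d) ℝ) :
    (Wᵀ * W).PosSemidef := by
  simpa using posSemidef_conjTranspose_mul_self W

open scoped MatrixOrder in
/-- For positive semidefinite `A` and `B`, the Frobenius form of `Z ↦ A * Z * B` is the squared
Frobenius norm of `C * Z * Mᵀ`, where `A = Cᵀ * C` and `B = Mᵀ * M`. -/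
theorem exists_trace_sandwich_eq {d : ℕ} {A B : Matrix (Fin d) (Fin d) ℝ}
    (hA : A.PosSemidef) (hB : B.PosSemidef) :
    ∃ C M : Matrix (Fin d) (Fin d) ℝ, A = Cᵀ * C ∧ B = Mᵀ * M ∧
      ∀ Z, ((A * Z * B)ᵀ * Z).trace = ((C * Z * Mᵀ)ᵀ * (C * Z * Mᵀ)).trace := by
  obtain ⟨C, hC⟩ := CStarAlgebra.nonneg_iff_eq_star_mul_self.mp hA.nonneg
  obtain ⟨M, hM⟩ := CStarAlgebra.nonneg_iff_eq_star_mul_self.mp hB.nonneg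
  rw [star_eq_conjTranspose, conjTranspose_eq_transpose_of_trivial] at hC hM
  refine ⟨C, M, hC, hM, fun Z => ?_⟩
  simp only [hC, hM, transpose_mul, transpose_transpose, Matrix.mul_assoc]
  rw [trace_mul_comm]
  conv_rhs => rw [trace_mul_comm]
  simp only [Matrix.mul_assoc]
  rw [trace_mul_comm]
  simp only [Matrix.mul_assoc]

theorem trace_sandwich_nonneg {d : ℕ} {A B : Matrix (Fin d) (Fin d) ℝ}
    (hA : A.PosSemidef) (hB : B.PosSemidef) (Z : Matrix (Fin d) (Fin d) ℝ) :
    0 ≤ ((A * Z * B)ᵀ * Z).trace := by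
  obtain ⟨C, M, -, -, h⟩ := exists_trace_sandwich_eq hA hB
  rw [h]
  exact (transpose_mul_self_posSemidef _).trace_nonneg

theorem trace_sandwich_pos {d : ℕ} {A B : Matrix (Fin d) (Fin d) ℝ}
    (hA : A.PosSemidef) (hB : B.PosSemidef) (hA' : IsUnit A) (hB' : IsUnit B)
    {Z : Matrix (Fin d) (Fin d) ℝ} (hZ : Z ≠ 0) :
    0 < ((A * Z * B)ᵀ * Z).trace := by
  refine (trace_sandwich_nonneg hA hB Z).lt_of_ne' fun h0 => hZ ?_
  obtain ⟨C, M, hC, hM, h⟩ := exists_trace_sandwich_eq hA hB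
  rw [h, ← conjTranspose_eq_transpose_of_trivial (C * Z * Mᵀ),
    trace_conjTranspose_mul_self_eq_zero_iff] at h0
  have hAZB : A * Z * B = 0 := by
    calc A * Z * B = Cᵀ * (C * Z * Mᵀ) * M := by simp only [hC, hM, Matrix.mul_assoc]
      _ = 0 := by simp [h0]
  exact hA'.mul_right_eq_zero.mp (hB'.mul_left_eq_zero.mp hAZB)

theorem trace_sandwich_symm {d : ℕ} {A B : Matrix (Fin d) (Fin d) ℝ}
    (hA : A.IsHermitian) (hB : B.IsHermitian) (X Y : Matrix (Fin d) (Fin d) ℝ) :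
    ((A * X * B)ᵀ * Y).trace = (Xᵀ * (A * Y * B)).trace := by
  rw [IsHermitian, conjTranspose_eq_transpose_of_trivial] at hA hB
  rw [transpose_mul, transpose_mul, hA, hB, Matrix.mul_assoc, trace_mul_comm]
  simp only [Matrix.mul_assoc]

theorem trace_transpose_dlnMap_mul {d : ℕ} (N : ℕ) (W X Y : Matrix (Fin d) (Fin d) ℝ) :
    ((dlnMap N W X)ᵀ * Y).trace = ∑ p ∈ Finset.Icc 1 N,
      ((mpow (W * Wᵀ) (((N : ℝ) - p) / N) * X *
        mpow (Wᵀ * W) (((p : ℝ) - 1) / N))ᵀ * Y).trace := by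
  rw [dlnMap, transpose_sum, Matrix.sum_mul, trace_sum]

/-- `dlnMap N W` as a linear map. -/
noncomputable def dlnLinearMap {d : ℕ} (N : ℕ) (W : Matrix (Fin d) (Fin d) ℝ) :
    Matrix (Fin d) (Fin d) ℝ →ₗ[ℝ] Matrix (Fin d) (Fin d) ℝ where
  toFun := dlnMap N W
  map_add' X Y := by simp [dlnMap, Matrix.mul_add, Matrix.add_mul, Finset.sum_add_distrib]
  map_smul' c X := by simp [dlnMap, Finset.smul_sum]

/-- The operator `A_{N,W}` is self-adjoint and positive
semidefinite for the Frobenius inner product `⟨A,B⟩_F = Tr(AᵀB)`; if `W` is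
invertible it is positive definite, hence invertible (bijective). -/
theorem dln_operator_selfadjoint_psd {d N : ℕ} (hN : 1 ≤ N)
    (W : Matrix (Fin d) (Fin d) ℝ) :
    (∀ Z₁ Z₂ : Matrix (Fin d) (Fin d) ℝ,
        ((dlnMap N W Z₁)ᵀ * Z₂).trace = (Z₁ᵀ * dlnMap N W Z₂).trace)
    ∧ (∀ Z : Matrix (Fin d) (Fin d) ℝ, 0 ≤ ((dlnMap N W Z)ᵀ * Z).trace)
    ∧ (IsUnit W →
        (∀ Z : Matrix (Fin d) (Fin d) ℝ, Z ≠ 0 → 0 < ((dlnMap N W Z)ᵀ * Z).trace)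
        ∧ Function.Bijective (dlnMap N W)) := by
  have hA (s : ℝ) := mpow_posSemidef (mul_transpose_self_posSemidef W) s
  have hB (s : ℝ) := mpow_posSemidef (transpose_mul_self_posSemidef W) s
  refine ⟨fun X Y => ?_, fun Z => ?_, fun hW => ?_⟩
  · rw [trace_transpose_dlnMap_mul, dlnMap, Matrix.mul_sum, trace_sum]
    exact Finset.sum_congr rfl fun p _ =>
      trace_sandwich_symm (hA _).isHermitian (hB _).isHermitian X Y
  · rw [trace_transpose_dlnMap_mul]
    exact Finset.sum_nonneg fun p _ => trace_sandwich_nonneg (hA _) (hB _) Z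
  · have hWt : IsUnit Wᵀ := W.isUnit_transpose.mpr hW
    have hA' (s : ℝ) : IsUnit (mpow (W * Wᵀ) s) := mpow_isUnit
      ((mul_transpose_self_posSemidef W).posDef_iff_isUnit.mpr (hW.mul hWt)) s
    have hB' (s : ℝ) : IsUnit (mpow (Wᵀ * W) s) := mpow_isUnit
      ((transpose_mul_self_posSemidef W).posDef_iff_isUnit.mpr (hWt.mul hW)) s
    have hpos (Z : Matrix (Fin d) (Fin d) ℝ) (hZ : Z ≠ 0) :
        0 < ((dlnMap N W Z)ᵀ * Z).trace := by
      rw [trace_transpose_dlnMap_mul]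
      exact Finset.sum_pos
        (fun p _ => trace_sandwich_pos (hA _) (hB _) (hA' _) (hB' _) hZ)
        (Finset.nonempty_Icc.mpr hN)
    have hinj : Function.Injective (dlnLinearMap N W) := by
      refine (injective_iff_map_eq_zero _).mpr fun Z hZ => ?_
      by_contra hne
      have hZ' : dlnMap N W Z = 0 := hZ
      simpa [hZ'] using hpos Z hne
    exact ⟨hpos, hinj, LinearMap.injective_iff_surjective.mp hinj⟩
end

section
/- (Determinant of the DLN metric operator; content of the volume-form theorem of Cohen–Menon–Veraszto.) Let W ∈ M_d have distinct positive singular values σ_1 > σ_2 > ⋯ > σ_d > 0, and let A_{N,W} : M_d → M_d be the linear map Z ↦ ∑_{p=1}^N (WWᵀ)^{(N−p)/N} Z (WᵀW)^{(p−1)/N}. Then the determinant of A_{N,W} as a linear endomorphism of the d²-dimensional real vector space M_d equals ∏_{k=1}^d (N σ_k^{2(N−1)/N}) · ∏_{1 ≤ k < l ≤ d} ((σ_k² − σ_l²)/(σ_k^{2/N} − σ_l^{2/N}))². -/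
open Matrix BigOperators

attribute [local instance] Matrix.normedAddCommGroup Matrix.normedSpace

/-- The DLN operator `A_{N,W}` as a linear endomorphism of `M_d`. -/
noncomputable def dlnLin {d : ℕ} (N : ℕ) (W : Matrix (Fin d) (Fin d) ℝ) :
    Matrix (Fin d) (Fin d) ℝ →ₗ[ℝ] Matrix (Fin d) (Fin d) ℝ where
  toFun Z := ∑ p ∈ Finset.Icc 1 N,
    mpow (W * Wᵀ) (((N : ℝ) - p) / N) * Z * mpow (Wᵀ * W) (((p : ℝ) - 1) / N)
  map_add' x y := by
    simp [Matrix.mul_add, Matrix.add_mul, Finset.sum_add_distrib]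
  map_smul' c x := by
    simp [Matrix.mul_smul, Matrix.smul_mul, Finset.smul_sum]

/-- Real powers of an orthogonally diagonalized matrix act on the diagonal. -/
theorem mpow_conj_diagonal {d : ℕ} {Q : Matrix (Fin d) (Fin d) ℝ} (hQ : Qᵀ * Q = 1)
    (a : Fin d → ℝ) (s : ℝ) :
    mpow (Q * diagonal a * Qᵀ) s = Q * diagonal (fun i => a i ^ s) * Qᵀ := by
  have h : (Q * diagonal a * Qᵀ).IsHermitian := by
    simp [IsHermitian, conjTranspose_eq_transpose_of_trivial, Matrix.mul_assoc]
  have hQ' : Q * Qᵀ = 1 := mul_eq_one_comm.mp hQ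
  rw [mpow, dif_pos h]
  set E : Matrix (Fin d) (Fin d) ℝ := ↑h.eigenvectorUnitary
  have hE₁ : star E * E = 1 := Unitary.coe_star_mul_self h.eigenvectorUnitary
  have hE₂ : E * star E = 1 := Unitary.coe_mul_star_self h.eigenvectorUnitary
  have hspec : Q * diagonal a * Qᵀ = E * diagonal h.eigenvalues * star E := by
    have := h.spectral_theorem
    rw [Unitary.conjStarAlgAut_apply] at this
    exact this
  clear_value E
  generalize h.eigenvalues = l at hspec ⊢
  have hcomm : diagonal l * (star E * Q) = star E * Q * diagonal a := by
    calc diagonal l * (star E * Q)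
        = star E * E * diagonal l * star E * Q := by
          rw [hE₁, Matrix.one_mul, Matrix.mul_assoc]
      _ = star E * (E * diagonal l * star E) * Q := by
          simp only [Matrix.mul_assoc]
      _ = star E * Q * diagonal a * (Qᵀ * Q) := by
          rw [← hspec]; simp only [Matrix.mul_assoc]
      _ = star E * Q * diagonal a := by rw [hQ, Matrix.mul_one]
  have hcomm' : diagonal (fun i => l i ^ s) * (star E * Q)
      = star E * Q * diagonal (fun i => a i ^ s) := by
    ext i j
    have hij := congrFun (congrFun hcomm i) j
    rw [diagonal_mul, mul_diagonal] at hij ⊢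
    by_cases hX : (star E * Q) i j = 0
    · simp [hX]
    · have : l i = a j := by
        rw [mul_comm] at hij
        exact mul_left_cancel₀ hX hij
      rw [this, mul_comm]
  calc E * diagonal (fun i => l i ^ s) * star E
      = E * (diagonal (fun i => l i ^ s) * (star E * Q)) * Qᵀ := by
        simp only [Matrix.mul_assoc, hQ', Matrix.mul_one]
    _ = (E * star E) * Q * diagonal (fun i => a i ^ s) * Qᵀ := by
        rw [hcomm']; simp only [Matrix.mul_assoc]
    _ = Q * diagonal (fun i => a i ^ s) * Qᵀ := by rw [hE₂, Matrix.one_mul]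

/-- The linear equivalence `Z ↦ U * Z * Vᵀ` for orthogonal `U` and `V`. -/
def orthogonalSandwich {d : ℕ} {U V : Matrix (Fin d) (Fin d) ℝ}
    (hU : Uᵀ * U = 1) (hV : Vᵀ * V = 1) :
    Matrix (Fin d) (Fin d) ℝ ≃ₗ[ℝ] Matrix (Fin d) (Fin d) ℝ where
  toFun Z := U * Z * Vᵀ
  invFun Z := Uᵀ * Z * V
  map_add' x y := by simp [Matrix.mul_add, Matrix.add_mul]
  map_smul' c x := by simp
  left_inv Z := by
    calc Uᵀ * (U * Z * Vᵀ) * V = (Uᵀ * U) * Z * (Vᵀ * V) := by simp only [Matrix.mul_assoc]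
      _ = Z := by rw [hU, hV, Matrix.one_mul, Matrix.mul_one]
  right_inv Z := by
    calc U * (Uᵀ * Z * V) * Vᵀ = (U * Uᵀ) * Z * (V * Vᵀ) := by simp only [Matrix.mul_assoc]
      _ = Z := by
        rw [mul_eq_one_comm.mp hU, mul_eq_one_comm.mp hV, Matrix.one_mul, Matrix.mul_one]

/-- The determinant of a linear map that scales every matrix entry is the product of the scaling
factors. -/
theorem det_of_entrywise_smul {m n : Type*} [Fintype m] [Fintype n]
    (f : Matrix m n ℝ →ₗ[ℝ] Matrix m n ℝ) (c : m → n → ℝ)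
    (hf : ∀ Z i j, f Z i j = c i j * Z i j) :
    LinearMap.det f = ∏ q : m × n, c q.1 q.2 := by
  classical
  have : f = Matrix.toLin (Matrix.stdBasis ℝ m n) (Matrix.stdBasis ℝ m n)
      (diagonal fun q : m × n => c q.1 q.2) := by
    refine (Matrix.stdBasis ℝ m n).ext fun q => ?_
    rw [Matrix.toLin_self, Finset.sum_eq_single q]
    · ext i j
      rw [hf, diagonal_apply_eq, Matrix.smul_apply, smul_eq_mul, Matrix.stdBasis_eq_single]
      by_cases h : q.1 = i ∧ q.2 = j
      · rw [h.1, h.2]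
      · rw [single_apply_of_ne _ _ _ _ _ h]; simp
    · intro b _ hb
      rw [diagonal_apply_ne _ hb, zero_smul]
    · simp
  rw [this, LinearMap.det_toLin, det_diagonal]

/-- The factor by which the DLN operator scales the entry in the singular directions of `x`
and `y`. -/
noncomputable def dlnEigenvalue (N : ℕ) (x y : ℝ) : ℝ :=
  ∑ p ∈ Finset.Icc 1 N, (x ^ 2) ^ (((N : ℝ) - p) / N) * (y ^ 2) ^ (((p : ℝ) - 1) / N)

theorem dlnEigenvalue_eq_geom_sum {N : ℕ} {x y : ℝ} (hx : 0 < x) (hy : 0 < y) :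
    dlnEigenvalue N x y = ∑ i ∈ Finset.range N,
      (y ^ ((2 : ℝ) / N)) ^ i * (x ^ ((2 : ℝ) / N)) ^ (N - 1 - i) := by
  rw [dlnEigenvalue, Finset.range_eq_Ico, ← Finset.Ico_add_one_right_eq_Icc,
    ← Finset.sum_Ico_add' _ 0 N 1]
  refine Finset.sum_congr rfl fun i hi => ?_
  have hiN : i + 1 ≤ N := (Finset.mem_Ico.mp hi).2
  rw [mul_comm]
  simp only [← Real.rpow_natCast, ← Real.rpow_mul hx.le, ← Real.rpow_mul hy.le]
  rw [Nat.sub_sub, Nat.cast_sub (by omega)]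
  push_cast
  congr 2 <;> ring

theorem dlnEigenvalue_self {N : ℕ} (hN : 1 ≤ N) {x : ℝ} (hx : 0 < x) :
    dlnEigenvalue N x x = N * x ^ (2 * ((N : ℝ) - 1) / N) := by
  rw [dlnEigenvalue_eq_geom_sum hx hx]
  have : ∀ i ∈ Finset.range N, (x ^ ((2 : ℝ) / N)) ^ i * (x ^ ((2 : ℝ) / N)) ^ (N - 1 - i)
      = x ^ (2 * ((N : ℝ) - 1) / N) := by
    intro i hi
    have hiN := Finset.mem_range.mp hi
    rw [← pow_add, Nat.add_sub_cancel' (by omega), ← Real.rpow_natCast, ← Real.rpow_mul hx.le,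
      Nat.cast_sub hN]
    push_cast
    congr 1; ring
  rw [Finset.sum_congr rfl this]
  simp

theorem dlnEigenvalue_comm {N : ℕ} {x y : ℝ} (hx : 0 < x) (hy : 0 < y) :
    dlnEigenvalue N x y = dlnEigenvalue N y x := by
  rw [dlnEigenvalue_eq_geom_sum hx hy, dlnEigenvalue_eq_geom_sum hy hx,
    (Commute.all _ _).geom_sum₂_comm]

theorem dlnEigenvalue_of_lt {N : ℕ} (hN : 1 ≤ N) {x y : ℝ} (hy : 0 < y) (hxy : y < x) :
    dlnEigenvalue N x y = (x ^ 2 - y ^ 2) / (x ^ ((2 : ℝ) / N) - y ^ ((2 : ℝ) / N)) := by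
  have hx : 0 < x := hy.trans hxy
  have hN' : (0 : ℝ) < N := by exact_mod_cast hN
  have hlt : y ^ ((2 : ℝ) / N) < x ^ ((2 : ℝ) / N) :=
    Real.rpow_lt_rpow hy.le hxy (by positivity)
  have hpow : ∀ {z : ℝ}, 0 < z → (z ^ ((2 : ℝ) / N)) ^ N = z ^ 2 := by
    intro z hz
    rw [← Real.rpow_natCast, ← Real.rpow_mul hz.le, div_mul_cancel₀ _ hN'.ne']
    exact Real.rpow_natCast z 2
  rw [dlnEigenvalue_comm hx hy, dlnEigenvalue_eq_geom_sum hy hx, eq_div_iff (sub_pos.2 hlt).ne',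
    geom_sum₂_mul, hpow hx, hpow hy]

/-- In singular coordinates the DLN operator scales the matrix entries. -/
theorem det_dlnLin_eq_prod {d N : ℕ} {U V : Matrix (Fin d) (Fin d) ℝ} {σ : Fin d → ℝ}
    (hU : Uᵀ * U = 1) (hV : Vᵀ * V = 1) :
    LinearMap.det (dlnLin N (U * diagonal σ * Vᵀ))
      = ∏ q : Fin d × Fin d, dlnEigenvalue N (σ q.1) (σ q.2) := by
  have hWWt : (U * diagonal σ * Vᵀ) * (U * diagonal σ * Vᵀ)ᵀ
      = U * diagonal (fun i => σ i ^ 2) * Uᵀ := by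
    calc _ = U * diagonal σ * (Vᵀ * V) * diagonal σ * Uᵀ := by
          simp [Matrix.mul_assoc]
      _ = _ := by
          rw [hV, Matrix.mul_one, Matrix.mul_assoc U, diagonal_mul_diagonal]
          simp only [sq]
  have hWtW : (U * diagonal σ * Vᵀ)ᵀ * (U * diagonal σ * Vᵀ)
      = V * diagonal (fun i => σ i ^ 2) * Vᵀ := by
    calc _ = V * diagonal σ * (Uᵀ * U) * diagonal σ * Vᵀ := by
          simp [Matrix.mul_assoc]
      _ = _ := by
          rw [hU, Matrix.mul_one, Matrix.mul_assoc V, diagonal_mul_diagonal]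
          simp only [sq]
  rw [← LinearMap.det_conj _ (orthogonalSandwich hU hV).symm]
  refine det_of_entrywise_smul _ (fun i j => dlnEigenvalue N (σ i) (σ j)) fun Z i j => ?_
  change (Uᵀ * dlnLin N (U * diagonal σ * Vᵀ) (U * Z * Vᵀ) * V : Matrix (Fin d) (Fin d) ℝ) i j = _
  rw [dlnLin, LinearMap.coe_mk, AddHom.coe_mk]
  simp only [hWWt, hWtW, mpow_conj_diagonal hU, mpow_conj_diagonal hV]
  rw [Matrix.mul_sum, Matrix.sum_mul, Matrix.sum_apply, dlnEigenvalue, Finset.sum_mul]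
  refine Finset.sum_congr rfl fun p _ => ?_
  set a : Fin d → ℝ := fun i => (σ i ^ 2) ^ (((N : ℝ) - p) / N)
  set b : Fin d → ℝ := fun i => (σ i ^ 2) ^ (((p : ℝ) - 1) / N)
  have : Uᵀ * (U * diagonal a * Uᵀ * (U * Z * Vᵀ) * (V * diagonal b * Vᵀ)) * V
      = diagonal a * Z * diagonal b := by
    calc _ = (Uᵀ * U) * diagonal a * (Uᵀ * U) * Z * (Vᵀ * V) * diagonal b * (Vᵀ * V) := by
          simp only [Matrix.mul_assoc]
      _ = _ := by rw [hU, hV]; simp only [Matrix.mul_one, Matrix.one_mul]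
  rw [this, mul_diagonal, diagonal_mul]
  ring

/-- A product of a symmetric function over all pairs splits into the diagonal and the squared
product over increasing pairs. -/
theorem prod_pairs_of_symm {ι M : Type*} [Fintype ι] [LinearOrder ι] [CommMonoid M]
    (g : ι → ι → M) (hg : ∀ i j, g i j = g j i) :
    ∏ q : ι × ι, g q.1 q.2
      = (∏ i, g i i) * ∏ q ∈ Finset.univ.filter (fun q : ι × ι => q.1 < q.2), g q.1 q.2 ^ 2 := by
  have hdiag : ∏ q ∈ Finset.univ.filter (fun q : ι × ι => q.1 = q.2), g q.1 q.2
      = ∏ i, g i i := by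
    refine (Finset.prod_bij (fun i _ => (i, i)) ?_ ?_ ?_ ?_).symm <;> simp
  have hgt : ∏ q ∈ Finset.univ.filter (fun q : ι × ι => q.2 < q.1), g q.1 q.2
      = ∏ q ∈ Finset.univ.filter (fun q : ι × ι => q.1 < q.2), g q.1 q.2 :=
    Finset.prod_equiv (Equiv.prodComm ι ι) (by simp) fun q _ => hg q.1 q.2
  rw [← Finset.prod_filter_mul_prod_filter_not Finset.univ (fun q : ι × ι => q.1 = q.2), hdiag,
    ← Finset.prod_filter_mul_prod_filter_not
      (Finset.univ.filter fun q : ι × ι => ¬ q.1 = q.2) (fun q : ι × ι => q.1 < q.2),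
    Finset.filter_filter, Finset.filter_filter, Finset.prod_pow, sq]
  congr 2
  · refine Finset.prod_congr (Finset.filter_congr fun q _ => ?_) fun _ _ => rfl
    exact ⟨And.right, fun h => ⟨h.ne, h⟩⟩
  · rw [← hgt]
    refine Finset.prod_congr (Finset.filter_congr fun q _ => ?_) fun _ _ => rfl
    exact ⟨fun h => lt_of_le_of_ne (not_lt.1 h.2) (Ne.symm h.1), fun h => ⟨h.ne', h.not_gt⟩⟩

/-- **determinant of the DLN metric operator, Cohen–Menon–Veraszto.**
For `W` with distinct positive singular values `σ_1 > ⋯ > σ_d > 0`,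
`det A_{N,W} = ∏_k N σ_k^{2(N−1)/N} · ∏_{k<l} ((σ_k²−σ_l²)/(σ_k^{2/N}−σ_l^{2/N}))²`. -/
theorem dln_operator_det {d N : ℕ} (hN : 1 ≤ N)
    (U V : Matrix (Fin d) (Fin d) ℝ) (σ : Fin d → ℝ)
    (hU : Uᵀ * U = 1) (hV : Vᵀ * V = 1)
    (hpos : ∀ i, 0 < σ i) (hdec : ∀ i j : Fin d, i < j → σ j < σ i)
    (W : Matrix (Fin d) (Fin d) ℝ)
    (hW : W = U * Matrix.diagonal σ * Vᵀ) :
    LinearMap.det (dlnLin N W)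
      = (∏ k, (N : ℝ) * σ k ^ (2 * ((N : ℝ) - 1) / N)) *
        ∏ q ∈ Finset.univ.filter (fun q : Fin d × Fin d => q.1 < q.2),
          ((σ q.1 ^ 2 - σ q.2 ^ 2) / (σ q.1 ^ ((2 : ℝ) / N) - σ q.2 ^ ((2 : ℝ) / N))) ^ 2 := by
  subst hW
  rw [det_dlnLin_eq_prod hU hV, prod_pairs_of_symm (fun i j => dlnEigenvalue N (σ i) (σ j))
    fun i j => dlnEigenvalue_comm (hpos i) (hpos j)]
  congr 1
  · exact Finset.prod_congr rfl fun k _ => dlnEigenvalue_self hN (hpos k)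
  · refine Finset.prod_congr rfl fun q hq => ?_
    rw [dlnEigenvalue_of_lt hN (hpos q.2) (hdec _ _ (Finset.mem_filter.1 hq).2)]
end

section
/- (Fibers of the end-to-end map over invertible matrices are orbits of the orthogonal group action.) Let 𝐖 = (W_N,…,W_1) ∈ M_d^N be balanced and suppose the end-to-end matrix W = W_N⋯W_1 is invertible. Then there exist orthogonal matrices Q_0, Q_1, …, Q_N ∈ O(d) and a diagonal matrix Λ with strictly positive diagonal entries such that W_p = Q_p Λ Q_{p−1}ᵀ for every p ∈ {1,…,N}; consequently W = Q_N Λ^N Q_0ᵀ is a singular value decomposition of W with singular values the entries of Λ^N. -/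
open Matrix BigOperators

attribute [local instance] Matrix.normedAddCommGroup Matrix.normedSpace

theorem isUnit_of_isUnit_Bprod {d : ℕ} (W : ℕ → Matrix (Fin d) (Fin d) ℝ) {N : ℕ}
    (h : IsUnit (Bprod W N)) {p : ℕ} (h1 : 1 ≤ p) (hp : p ≤ N) : IsUnit (W p) := by
  induction N with
  | zero => omega
  | succ n ih =>
    rw [Bprod_succ, Matrix.isUnit_iff_isUnit_det, Matrix.det_mul, IsUnit.mul_iff,
      ← Matrix.isUnit_iff_isUnit_det, ← Matrix.isUnit_iff_isUnit_det] at h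
    rcases hp.lt_or_eq with hlt | rfl
    · exact ih h.2 (by omega)
    · exact h.1

/-- The Gram matrix of an invertible real matrix is orthogonally diagonalizable with
positive eigenvalues, written as squares. -/
theorem exists_orthogonal_diagonalization_gram {d : ℕ} {A : Matrix (Fin d) (Fin d) ℝ}
    (hA : IsUnit A) :
    ∃ (Q : Matrix (Fin d) (Fin d) ℝ) (Λ : Fin d → ℝ),
      Qᵀ * Q = 1 ∧ (∀ i, 0 < Λ i) ∧
        Aᵀ * A = Q * (diagonal Λ * diagonal Λ) * Qᵀ := by
  have hpd : (Aᵀ * A).PosDef := by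
    have := Matrix.PosDef.conjTranspose_mul_self A (Matrix.mulVec_injective_of_isUnit hA)
    rwa [Matrix.conjTranspose_eq_transpose_of_trivial] at this
  have hspec := hpd.isHermitian.spectral_theorem
  refine ⟨hpd.isHermitian.eigenvectorUnitary, fun i => √(hpd.isHermitian.eigenvalues i),
    ?_, fun i => Real.sqrt_pos.2 (hpd.eigenvalues_pos i), ?_⟩
  · have := Unitary.coe_star_mul_self hpd.isHermitian.eigenvectorUnitary
    rwa [Matrix.star_eq_conjTranspose, Matrix.conjTranspose_eq_transpose_of_trivial] at this
  · have hsq : (diagonal fun i => √(hpd.isHermitian.eigenvalues i)) *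
        (diagonal fun i => √(hpd.isHermitian.eigenvalues i)) =
        diagonal (hpd.isHermitian.eigenvalues) := by
      rw [Matrix.diagonal_mul_diagonal]
      exact congrArg _ (funext fun i => Real.mul_self_sqrt (hpd.eigenvalues_pos i).le)
    rw [hsq, ← Matrix.conjTranspose_eq_transpose_of_trivial
      (hpd.isHermitian.eigenvectorUnitary : Matrix (Fin d) (Fin d) ℝ),
      ← Matrix.star_eq_conjTranspose]
    exact hspec

/-- The orthogonal factors obtained by transporting `Q₀` along the tuple `W`. -/
noncomputable def orthogonalFactor {d : ℕ} (W : ℕ → Matrix (Fin d) (Fin d) ℝ)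
    (Q₀ : Matrix (Fin d) (Fin d) ℝ) (Λ : Fin d → ℝ) : ℕ → Matrix (Fin d) (Fin d) ℝ
  | 0 => Q₀
  | p + 1 => W (p + 1) * orthogonalFactor W Q₀ Λ p * diagonal fun i => (Λ i)⁻¹

theorem orthogonalFactor_succ_spec {d : ℕ} {A Q D E : Matrix (Fin d) (Fin d) ℝ}
    (hQ : Qᵀ * Q = 1) (hED : E * D = 1) (hE : Eᵀ = E)
    (hA : Aᵀ * A = Q * (D * D) * Qᵀ) :
    (A * Q * E)ᵀ * (A * Q * E) = 1 ∧ A = A * Q * E * D * Qᵀ ∧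
      A * Aᵀ = A * Q * E * (D * D) * (A * Q * E)ᵀ := by
  have hQ' : Q * Qᵀ = 1 := mul_eq_one_comm.1 hQ
  have hDE : D * E = 1 := mul_eq_one_comm.1 hED
  refine ⟨?_, ?_, ?_⟩
  · calc (A * Q * E)ᵀ * (A * Q * E) = E * Qᵀ * (Aᵀ * A) * Q * E := by
          simp only [Matrix.transpose_mul, hE, Matrix.mul_assoc]
      _ = E * (Qᵀ * Q) * D * (D * (Qᵀ * Q) * E) := by
          rw [hA]; simp only [Matrix.mul_assoc]
      _ = 1 := by rw [hQ, mul_one, mul_one, hED, hDE, mul_one]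
  · rw [Matrix.mul_assoc _ E D, hED, mul_one, Matrix.mul_assoc, hQ', mul_one]
  · calc A * Aᵀ = A * (Q * Qᵀ) * Aᵀ := by rw [hQ', mul_one]
      _ = A * Q * (E * D) * (D * E) * Qᵀ * Aᵀ := by
          rw [hED, hDE, mul_one, mul_one, Matrix.mul_assoc A Q]
      _ = A * Q * E * (D * D) * (A * Q * E)ᵀ := by
          simp only [Matrix.transpose_mul, hE, Matrix.mul_assoc]

/-- **fibers over invertible matrices are orthogonal-group orbits.**
A balanced tuple with invertible end-to-end matrix `W = W_N⋯W_1` admits a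
parametrization `W_p = Q_p Λ Q_{p−1}ᵀ` with `Q_0,…,Q_N ∈ O(d)` and `Λ` diagonal
with strictly positive entries; consequently `W = Q_N Λ^N Q_0ᵀ` is an SVD of `W`. -/
theorem dln_fiber_orbit {d N : ℕ} (hN : 1 ≤ N)
    (W : ℕ → Matrix (Fin d) (Fin d) ℝ)
    (hbal : BalancedTuple N W) (hinv : IsUnit (Bprod W N)) :
    ∃ (Q : ℕ → Matrix (Fin d) (Fin d) ℝ) (Λ : Fin d → ℝ),
      (∀ p ≤ N, (Q p)ᵀ * Q p = 1 ∧ Q p * (Q p)ᵀ = 1)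
      ∧ (∀ i, 0 < Λ i)
      ∧ (∀ p, 1 ≤ p → p ≤ N → W p = Q p * Matrix.diagonal Λ * (Q (p - 1))ᵀ)
      ∧ Bprod W N = Q N * Matrix.diagonal (fun i => Λ i ^ N) * (Q 0)ᵀ := by
  obtain ⟨Q₀, Λ, hQ₀, hΛ, hgram⟩ :=
    exists_orthogonal_diagonalization_gram (isUnit_of_isUnit_Bprod W hinv le_rfl hN)
  have hED : (diagonal fun i => (Λ i)⁻¹) * diagonal Λ = 1 := by
    rw [Matrix.diagonal_mul_diagonal, ← Matrix.diagonal_one]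
    exact congrArg _ (funext fun i => inv_mul_cancel₀ (hΛ i).ne')
  set Q := orthogonalFactor W Q₀ Λ
  have hstep (p : ℕ) (hQ : (Q p)ᵀ * Q p = 1)
      (hg : (W (p + 1))ᵀ * W (p + 1) = Q p * (diagonal Λ * diagonal Λ) * (Q p)ᵀ) :
      (Q (p + 1))ᵀ * Q (p + 1) = 1 ∧ W (p + 1) = Q (p + 1) * diagonal Λ * (Q p)ᵀ ∧
        W (p + 1) * (W (p + 1))ᵀ =
          Q (p + 1) * (diagonal Λ * diagonal Λ) * (Q (p + 1))ᵀ :=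
    orthogonalFactor_succ_spec hQ hED (Matrix.diagonal_transpose _) hg
  have hinvariant (p : ℕ) (hp : p < N) : (Q p)ᵀ * Q p = 1 ∧
      (W (p + 1))ᵀ * W (p + 1) = Q p * (diagonal Λ * diagonal Λ) * (Q p)ᵀ := by
    induction p with
    | zero => exact ⟨hQ₀, hgram⟩
    | succ p ih =>
      obtain ⟨hQ, hg⟩ := ih (by omega)
      obtain ⟨h₁, -, h₃⟩ := hstep p hQ hg
      exact ⟨h₁, (hbal (p + 1) (by omega) hp).trans h₃⟩
  have horth (p : ℕ) (hp : p ≤ N) : (Q p)ᵀ * Q p = 1 := by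
    cases p with
    | zero => exact hQ₀
    | succ p => exact (hstep p (hinvariant p hp).1 (hinvariant p hp).2).1
  have hfactor (p : ℕ) (hp : p < N) : W (p + 1) = Q (p + 1) * diagonal Λ * (Q p)ᵀ :=
    (hstep p (hinvariant p hp).1 (hinvariant p hp).2).2.1
  have hprod (p : ℕ) (hp : p ≤ N) :
      Bprod W p = Q p * (diagonal fun i => Λ i ^ p) * (Q 0)ᵀ := by
    induction p with
    | zero => simpa [Bprod_zero] using (mul_eq_one_comm.1 (horth 0 hp)).symm
    | succ p ih =>
      have hpow : (diagonal fun i => Λ i ^ (p + 1)) =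
          diagonal Λ * diagonal fun i => Λ i ^ p := by
        simp only [Matrix.diagonal_mul_diagonal, pow_succ']
      calc Bprod W (p + 1)
          = Q (p + 1) * diagonal Λ * ((Q p)ᵀ * Q p) *
              (diagonal fun i => Λ i ^ p) * (Q 0)ᵀ := by
            rw [Bprod_succ, ih (by omega), hfactor p hp]
            simp only [Matrix.mul_assoc]
        _ = Q (p + 1) * (diagonal fun i => Λ i ^ (p + 1)) * (Q 0)ᵀ := by
            rw [horth p (by omega), mul_one, hpow]
            simp only [Matrix.mul_assoc]
  refine ⟨Q, Λ, fun p hp => ⟨horth p hp, mul_eq_one_comm.1 (horth p hp)⟩, hΛ,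
    fun p h₁ hp => ?_, hprod N le_rfl⟩
  obtain ⟨p, rfl⟩ := Nat.exists_eq_add_of_le' h₁
  exact hfactor p hp
end

section
/- (Orthogonality of diagonal and rotational tangent directions on the balanced manifold.) Let Q_0,…,Q_N ∈ O(d), let Λ be a diagonal matrix, and set W_p = Q_p Λ Q_{p−1}ᵀ for 1 ≤ p ≤ N. For a diagonal matrix θ define 𝐥(θ) ∈ M_d^N with s-th component Q_s θ Q_{s−1}ᵀ, and for a tuple 𝐀 = (A_N,…,A_0) of antisymmetric matrices define 𝐯(𝐀) ∈ M_d^N with s-th component A_s W_s − W_s A_{s−1} (1 ≤ s ≤ N). Then for all diagonal θ, θ' and all antisymmetric tuples 𝐀: ⟨𝐥(θ), 𝐯(𝐀)⟩ = 0 and ⟨𝐥(θ), 𝐥(θ')⟩ = N Tr(θθ'), where ⟨𝐔,𝐕⟩ = ∑_{s=1}^N Tr(U_sᵀ V_s) is the Frobenius inner product on M_d^N. -/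
open Matrix BigOperators

attribute [local instance] Matrix.normedAddCommGroup Matrix.normedSpace

/-- The product of a symmetric and an antisymmetric real matrix has trace zero. -/
theorem Matrix.IsSymm.trace_mul_eq_zero_of_transpose_eq_neg {n : Type*} [Fintype n]
    {S A : Matrix n n ℝ} (hS : S.IsSymm) (hA : Aᵀ = -A) : (S * A).trace = 0 := by
  have h : (S * A).trace = -(S * A).trace := by
    conv_lhs => rw [← Matrix.trace_transpose, Matrix.transpose_mul, hA, hS.eq, Matrix.neg_mul,
      Matrix.trace_neg, Matrix.trace_mul_comm]
  linarith

theorem Matrix.isSymm_mul_diagonal_mul_transpose {n : Type*} [Fintype n] [DecidableEq n]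
    (U : Matrix n n ℝ) (v : n → ℝ) : (U * Matrix.diagonal v * Uᵀ).IsSymm := by
  simp [Matrix.IsSymm, Matrix.transpose_mul, Matrix.mul_assoc]

/-- If `U` is orthogonal, then `(U θ Vᵀ)ᵀ (U φ Vᵀ) = V θ φ Vᵀ` for diagonal `θ`, `φ`. -/
theorem Matrix.transpose_mul_diagonal_mul_cancel {n : Type*} [Fintype n] [DecidableEq n]
    {U : Matrix n n ℝ} (hU : Uᵀ * U = 1) (V : Matrix n n ℝ) (θ φ : n → ℝ) :
    (U * Matrix.diagonal θ * Vᵀ)ᵀ * (U * Matrix.diagonal φ * Vᵀ)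
      = V * Matrix.diagonal (fun i => θ i * φ i) * Vᵀ := by
  calc (U * Matrix.diagonal θ * Vᵀ)ᵀ * (U * Matrix.diagonal φ * Vᵀ)
      = V * (Matrix.diagonal θ * (Uᵀ * U) * Matrix.diagonal φ) * Vᵀ := by
        simp [Matrix.transpose_mul, Matrix.mul_assoc]
    _ = _ := by rw [hU, Matrix.mul_one, Matrix.diagonal_mul_diagonal]

/-- If `V` is orthogonal, then `(U φ Vᵀ) (U θ Vᵀ)ᵀ = U φ θ Uᵀ` for diagonal `θ`, `φ`. -/
theorem Matrix.mul_diagonal_mul_transpose_cancel {n : Type*} [Fintype n] [DecidableEq n]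
    (U : Matrix n n ℝ) {V : Matrix n n ℝ} (hV : Vᵀ * V = 1) (θ φ : n → ℝ) :
    (U * Matrix.diagonal φ * Vᵀ) * (U * Matrix.diagonal θ * Vᵀ)ᵀ
      = U * Matrix.diagonal (fun i => φ i * θ i) * Uᵀ := by
  calc (U * Matrix.diagonal φ * Vᵀ) * (U * Matrix.diagonal θ * Vᵀ)ᵀ
      = U * (Matrix.diagonal φ * (Vᵀ * V) * Matrix.diagonal θ) * Uᵀ := by
        simp [Matrix.transpose_mul, Matrix.mul_assoc]
    _ = _ := by rw [hV, Matrix.mul_one, Matrix.diagonal_mul_diagonal]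

/-- **orthogonality of diagonal and rotational tangent directions.**
With `W_p = Q_p Λ Q_{p−1}ᵀ`, the diagonal tangent tuples
`𝐥(θ)_s = Q_s θ Q_{s−1}ᵀ` and the rotational tuples
`𝐯(𝐀)_s = A_s W_s − W_s A_{s−1}` (with each `A_p` antisymmetric) satisfy
`⟨𝐥(θ), 𝐯(𝐀)⟩ = 0` and `⟨𝐥(θ), 𝐥(θ')⟩ = N Tr(θθ')` for the Frobenius
inner product `⟨𝐔,𝐕⟩ = ∑_{s=1}^N Tr(U_sᵀ V_s)` on `M_d^N`. -/
theorem dln_tangent_orthogonality {d N : ℕ} (hN : 1 ≤ N)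
    (Q : ℕ → Matrix (Fin d) (Fin d) ℝ) (hQ : ∀ p ≤ N, (Q p)ᵀ * Q p = 1)
    (Λ θ θ' : Fin d → ℝ)
    (A : ℕ → Matrix (Fin d) (Fin d) ℝ) (hA : ∀ p ≤ N, (A p)ᵀ = -A p) :
    (∑ s ∈ Finset.Icc 1 N,
        ((Q s * Matrix.diagonal θ * (Q (s - 1))ᵀ)ᵀ *
          (A s * (Q s * Matrix.diagonal Λ * (Q (s - 1))ᵀ)
            - (Q s * Matrix.diagonal Λ * (Q (s - 1))ᵀ) * A (s - 1))).trace = 0)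
    ∧ (∑ s ∈ Finset.Icc 1 N,
        ((Q s * Matrix.diagonal θ * (Q (s - 1))ᵀ)ᵀ *
          (Q s * Matrix.diagonal θ' * (Q (s - 1))ᵀ)).trace
        = N * ∑ i, θ i * θ' i) := by
  constructor
  · refine Finset.sum_eq_zero fun s hs => ?_
    have hs' : s ≤ N := (Finset.mem_Icc.mp hs).2
    have hp : s - 1 ≤ N := (Nat.sub_le s 1).trans hs'
    rw [Matrix.mul_sub, Matrix.trace_sub, ← Matrix.mul_assoc _ _ (A (s - 1)),
      Matrix.transpose_mul_diagonal_mul_cancel (hQ s hs'),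
      Matrix.trace_mul_comm, Matrix.mul_assoc (A s),
      Matrix.mul_diagonal_mul_transpose_cancel _ (hQ _ hp), Matrix.trace_mul_comm (A s),
      (Matrix.isSymm_mul_diagonal_mul_transpose _ _).trace_mul_eq_zero_of_transpose_eq_neg
        (hA s hs'),
      (Matrix.isSymm_mul_diagonal_mul_transpose _ _).trace_mul_eq_zero_of_transpose_eq_neg
        (hA _ hp), sub_zero]
  · have h : ∀ s ∈ Finset.Icc 1 N, ((Q s * Matrix.diagonal θ * (Q (s - 1))ᵀ)ᵀ *
        (Q s * Matrix.diagonal θ' * (Q (s - 1))ᵀ)).trace = ∑ i, θ i * θ' i := by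
      intro s hs
      have hs' : s ≤ N := (Finset.mem_Icc.mp hs).2
      rw [Matrix.transpose_mul_diagonal_mul_cancel (hQ s hs'), Matrix.trace_mul_comm,
        ← Matrix.mul_assoc, hQ _ ((Nat.sub_le s 1).trans hs'), Matrix.one_mul,
        Matrix.trace_diagonal]
    rw [Finset.sum_congr rfl h]
    simp
end

section
/- (Orthonormal basis of the tangent space of the balanced manifold, Menon–Yu.) Let Q_0,…,Q_N ∈ O(d) with q_{p,i} the i-th column of Q_p, and let Λ = diag(λ_1,…,λ_d) with distinct positive entries; set W_p = Q_p Λ Q_{p−1}ᵀ. Define, for 1 ≤ k ≤ d, the tuple l^k ∈ M_d^N with s-th component (1/√N) q_{s,k} q_{s−1,k}ᵀ; for 1 ≤ k < l ≤ d and 1 ≤ p ≤ N−1, the tuple u^{k,l,p} with s-th component a^{k,l,p,s} q_{s,k} q_{s−1,l}ᵀ + a^{l,k,p,s} q_{s,l} q_{s−1,k}ᵀ, where a^{k,l,p,s} = [N(λ_k² + λ_l² − 2λ_kλ_l cos(pπ/N))]^{−1/2} (λ_k sin((s−1)pπ/N) − λ_l sin(spπ/N)); the tuple u^{k,l,0}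 with s-th component √((λ_k² − λ_l²)/(λ_k^{2N} − λ_l^{2N})) λ_k^{s−1} λ_l^{N−s} q_{s,l} q_{s−1,k}ᵀ; and the tuple u^{k,l,N} with s-th component √((λ_k² − λ_l²)/(λ_k^{2N} − λ_l^{2N})) λ_k^{N−s} λ_l^{s−1} q_{s,k} q_{s−1,l}ᵀ. Then the family consisting of the d tuples l^k together with the (N+1)d(d−1)/2 tuples u^{k,l,p} (1 ≤ k < l ≤ d, 0 ≤ p ≤ N) is orthonormal in M_d^N with respect to the Frobenius inner product ⟨𝐔,𝐕⟩ = ∑_{s=1}^N Tr(U_sᵀ V_s). -/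
open Matrix BigOperators

attribute [local instance] Matrix.normedAddCommGroup Matrix.normedSpace

/-- The Frobenius inner product `⟨𝐔,𝐕⟩ = ∑_{s=1}^N Tr(U_sᵀ V_s)` on `M_d^N`. -/
noncomputable def tupInner {d : ℕ} (N : ℕ)
    (Uv Vv : ℕ → Matrix (Fin d) (Fin d) ℝ) : ℝ :=
  ∑ s ∈ Finset.Icc 1 N, ((Uv s)ᵀ * Vv s).trace

/-- The coefficient `a^{k,l,p,s}` of Menon–Yu. -/
noncomputable def acoef {d : ℕ} (N : ℕ) (lam : Fin d → ℝ) (k l : Fin d)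
    (p s : ℕ) : ℝ :=
  (Real.sqrt ((N : ℝ) * (lam k ^ 2 + lam l ^ 2
      - 2 * lam k * lam l * Real.cos (p * Real.pi / N))))⁻¹ *
    (lam k * Real.sin (((s : ℝ) - 1) * p * Real.pi / N)
      - lam l * Real.sin ((s : ℝ) * p * Real.pi / N))

/-- The tuple `l^k`, with `s`-th component `(1/√N) q_{s,k} q_{s−1,k}ᵀ`. -/
noncomputable def lvec {d : ℕ} (N : ℕ) (Q : ℕ → Matrix (Fin d) (Fin d) ℝ)
    (k : Fin d) (s : ℕ) : Matrix (Fin d) (Fin d) ℝ :=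
  (Real.sqrt N)⁻¹ • Matrix.vecMulVec (fun i => Q s i k) (fun i => Q (s - 1) i k)

/-- The tuples `u^{k,l,p}` of Menon–Yu (cases `p = 0`, `p = N`, `1 ≤ p ≤ N−1`). -/
noncomputable def uvec {d : ℕ} (N : ℕ) (Q : ℕ → Matrix (Fin d) (Fin d) ℝ)
    (lam : Fin d → ℝ) (k l : Fin d) (p s : ℕ) : Matrix (Fin d) (Fin d) ℝ :=
  if p = 0 then
    (Real.sqrt ((lam k ^ 2 - lam l ^ 2) / (lam k ^ (2 * N) - lam l ^ (2 * N))) *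
        lam k ^ (s - 1) * lam l ^ (N - s)) •
      Matrix.vecMulVec (fun i => Q s i l) (fun i => Q (s - 1) i k)
  else if p = N then
    (Real.sqrt ((lam k ^ 2 - lam l ^ 2) / (lam k ^ (2 * N) - lam l ^ (2 * N))) *
        lam k ^ (N - s) * lam l ^ (s - 1)) •
      Matrix.vecMulVec (fun i => Q s i k) (fun i => Q (s - 1) i l)
  else
    acoef N lam k l p s • Matrix.vecMulVec (fun i => Q s i k) (fun i => Q (s - 1) i l)
    + acoef N lam l k p s • Matrix.vecMulVec (fun i => Q s i l) (fun i => Q (s - 1) i k)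

theorem sum_Icc_one_eq_sum_range (N : ℕ) (f : ℕ → ℝ) :
    ∑ s ∈ Finset.Icc 1 N, f s = ∑ i ∈ Finset.range N, f (i + 1) := by
  induction N with
  | zero => simp
  | succ n ih => rw [Finset.sum_Icc_succ_top (by omega), ih, Finset.sum_range_succ]

/-- The sum rule `∑ (x vᵢ - y vᵢ₊₁)(x wᵢ - y wᵢ₊₁) + (y vᵢ - x vᵢ₊₁)(y wᵢ - x wᵢ₊₁)` for
`vᵢ = sin (i φ)`, `wᵢ = sin (i θ)`, when `v` vanishes at `N`. -/
theorem sum_sin_differences (N : ℕ) (x y φ θ : ℝ) (hφ : Real.sin (N * φ) = 0) :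
    ∑ i ∈ Finset.range N,
      ((x * Real.sin (i * φ) - y * Real.sin ((i + 1 : ℝ) * φ)) *
          (x * Real.sin (i * θ) - y * Real.sin ((i + 1 : ℝ) * θ)) +
        (y * Real.sin (i * φ) - x * Real.sin ((i + 1 : ℝ) * φ)) *
          (y * Real.sin (i * θ) - x * Real.sin ((i + 1 : ℝ) * θ))) =
      2 * (x ^ 2 + y ^ 2 - 2 * x * y * Real.cos θ) *
        ∑ i ∈ Finset.range N, Real.sin (i * φ) * Real.sin (i * θ) := by
  have htel := Finset.sum_range_sub (fun i : ℕ =>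
    (x ^ 2 + y ^ 2) * Real.sin (i * φ) * Real.sin (i * θ) -
      2 * x * y * Real.sin (i * φ) * Real.sin ((i - 1 : ℝ) * θ)) N
  simp only [hφ, Nat.cast_zero, zero_mul, mul_zero, Real.sin_zero, sub_zero] at htel
  rw [← sub_eq_zero, Finset.mul_sum, ← Finset.sum_sub_distrib, ← htel]
  refine Finset.sum_congr rfl fun i _ => ?_
  have h1 : Real.sin ((i + 1 : ℝ) * θ) + Real.sin ((i - 1 : ℝ) * θ) =
      2 * Real.cos θ * Real.sin (i * θ) := by
    rw [add_mul, sub_mul, one_mul, Real.sin_add, Real.sin_sub]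
    ring
  push_cast
  rw [add_sub_cancel_right]
  linear_combination (-2 * x * y * Real.sin (i * φ)) * h1

theorem sum_sin_mul_sin_eq_zero (N : ℕ) (φ θ : ℝ) (hφ : Real.sin (N * φ) = 0)
    (hθ : Real.sin (N * θ) = 0) (hcos : Real.cos φ ≠ Real.cos θ) :
    ∑ i ∈ Finset.range N, Real.sin (i * φ) * Real.sin (i * θ) = 0 := by
  have h1 := sum_sin_differences N 1 1 φ θ hφ
  have h2 := sum_sin_differences N 1 1 θ φ hθ
  simp only [mul_comm (Real.sin (_ * θ)) (Real.sin (_ * φ)),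
    mul_comm (_ * Real.sin (_ * θ) - _) (_ * Real.sin (_ * φ) - _)] at h2
  have h3 := h1.symm.trans h2
  refine (mul_eq_zero.1 (?_ : (Real.cos φ - Real.cos θ) * _ = 0)).resolve_left
    (sub_ne_zero.2 hcos)
  linear_combination h3 / 4

theorem sum_sin_sq_eq (N p : ℕ) (θ : ℝ) (hθ : N * θ = p * Real.pi) (hsin : Real.sin θ ≠ 0) :
    ∑ i ∈ Finset.range N, Real.sin (i * θ) * Real.sin (i * θ) = N / 2 := by
  have htel := Finset.sum_range_sub (fun i : ℕ => Real.sin ((2 * i - 1 : ℝ) * θ)) N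
  have hend : Real.sin ((2 * N - 1 : ℝ) * θ) = - Real.sin θ := by
    rw [show (2 * N - 1 : ℝ) * θ = p * (2 * Real.pi) - θ by linear_combination 2 * hθ,
      Real.sin_nat_mul_two_pi_sub]
  simp only [hend, Nat.cast_zero, mul_zero, zero_sub, neg_mul, one_mul, Real.sin_neg,
    sub_self] at htel
  have hterm : ∀ i : ℕ, Real.sin ((2 * (i + 1 : ℕ) - 1 : ℝ) * θ) -
      Real.sin ((2 * i - 1 : ℝ) * θ) =
      2 * Real.sin θ * (1 - 2 * (Real.sin (i * θ) * Real.sin (i * θ))) := by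
    intro i
    rw [show (2 * (i + 1 : ℕ) - 1 : ℝ) * θ = 2 * (i * θ) + θ by push_cast; ring,
      show (2 * i - 1 : ℝ) * θ = 2 * (i * θ) - θ by ring, Real.sin_add, Real.sin_sub,
      Real.cos_two_mul, Real.cos_sq']
    ring
  rw [Finset.sum_congr rfl fun i _ => hterm i, ← Finset.mul_sum, Finset.sum_sub_distrib,
    ← Finset.mul_sum] at htel
  have h := (mul_eq_zero.1 htel).resolve_left (mul_ne_zero two_ne_zero hsin)
  simp only [Finset.sum_const, Finset.card_range, nsmul_eq_mul, mul_one] at h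
  linarith

/-- The geometric weights `xⁱ yᴺ⁻¹⁻ⁱ` are orthogonal to the differences `y vᵢ - x vᵢ₊₁`
whenever `v` vanishes at both ends. -/
theorem sum_geom_mul_difference_eq_zero (N : ℕ) (x y : ℝ) (v : ℕ → ℝ) (h0 : v 0 = 0)
    (hN : v N = 0) :
    ∑ i ∈ Finset.range N, x ^ i * y ^ (N - (i + 1)) * (y * v i - x * v (i + 1)) = 0 := by
  have htel := Finset.sum_range_sub' (fun i : ℕ => x ^ i * y ^ (N - i) * v i) N
  simp only [h0, hN, mul_zero, sub_zero] at htel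
  rw [← htel]
  refine Finset.sum_congr rfl fun i hi => ?_
  have hi' : N - i = N - (i + 1) + 1 := by have := Finset.mem_range.1 hi; omega
  rw [hi']
  ring

theorem sum_geom_sq (N : ℕ) (hN : 1 ≤ N) {x y : ℝ} (hx : 0 < x) (hy : 0 < y) (hxy : x ≠ y) :
    ∑ i ∈ Finset.range N,
      (Real.sqrt ((x ^ 2 - y ^ 2) / (x ^ (2 * N) - y ^ (2 * N))) * x ^ i * y ^ (N - (i + 1))) *
      (Real.sqrt ((x ^ 2 - y ^ 2) / (x ^ (2 * N) - y ^ (2 * N))) * x ^ i * y ^ (N - (i + 1)))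
      = 1 := by
  have hS := (Commute.all (x ^ 2) (y ^ 2)).geom_sum₂_mul N
  rw [← pow_mul, ← pow_mul] at hS
  set S := ∑ i ∈ Finset.range N, (x ^ 2) ^ i * (y ^ 2) ^ (N - 1 - i) with hSdef
  have hSpos : 0 < S := Finset.sum_pos (fun i _ => by positivity)
    (Finset.nonempty_range_iff.2 (by omega))
  have hne : x ^ 2 - y ^ 2 ≠ 0 := by
    rw [sub_ne_zero]
    exact fun h => hxy ((pow_left_inj₀ hx.le hy.le two_ne_zero).1 h)
  have hquot : (x ^ 2 - y ^ 2) / (x ^ (2 * N) - y ^ (2 * N)) = S⁻¹ := by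
    rw [← hS]
    field_simp
  rw [hquot]
  have hsq : Real.sqrt S⁻¹ * Real.sqrt S⁻¹ = S⁻¹ := Real.mul_self_sqrt (by positivity)
  calc _ = ∑ i ∈ Finset.range N, S⁻¹ * ((x ^ 2) ^ i * (y ^ 2) ^ (N - 1 - i)) := by
        refine Finset.sum_congr rfl fun i _ => ?_
        rw [show N - (i + 1) = N - 1 - i by omega]
        linear_combination (x ^ i * y ^ (N - 1 - i)) ^ 2 * hsq
    _ = 1 := by rw [← Finset.mul_sum, ← hSdef, inv_mul_cancel₀ hSpos.ne']

theorem sq_add_sq_sub_cos_pos {x y θ : ℝ} (hx : 0 < x) (hy : 0 < y) (hxy : x ≠ y) :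
    0 < x ^ 2 + y ^ 2 - 2 * x * y * Real.cos θ := by
  have h1 : 0 < (x - y) ^ 2 := by
    have := sub_ne_zero.2 hxy
    positivity
  have h2 := mul_nonneg (mul_pos hx hy).le (sub_nonneg.2 (Real.cos_le_one θ))
  nlinarith

theorem acoef_succ {d : ℕ} (N : ℕ) (lam : Fin d → ℝ) (k l : Fin d) (p i : ℕ) :
    acoef N lam k l p (i + 1) =
      (Real.sqrt ((N : ℝ) * (lam k ^ 2 + lam l ^ 2
        - 2 * lam k * lam l * Real.cos (p * Real.pi / N))))⁻¹ *
      (lam k * Real.sin (i * (p * Real.pi / N))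
        - lam l * Real.sin ((i + 1 : ℝ) * (p * Real.pi / N))) := by
  unfold acoef
  push_cast
  rw [add_sub_cancel_right, mul_assoc (i : ℝ), mul_div_assoc (i : ℝ), mul_assoc (i + 1 : ℝ),
    mul_div_assoc (i + 1 : ℝ)]

theorem sin_nat_mul_angle {N : ℕ} (hN : 1 ≤ N) (p : ℕ) :
    Real.sin (N * (p * Real.pi / N)) = 0 := by
  have : (N : ℝ) ≠ 0 := by positivity
  rw [mul_div_cancel₀ _ this, Real.sin_nat_mul_pi]

theorem sum_acoef_mul_acoef {d N : ℕ} (lam : Fin d → ℝ)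
    (hpos : ∀ i, 0 < lam i) {k l : Fin d} (hkl : lam k ≠ lam l) {p p' : ℕ}
    (hp0 : 0 < p) (hpN : p < N) (hp0' : 0 < p') (hpN' : p' < N) :
    ∑ i ∈ Finset.range N,
      (acoef N lam k l p (i + 1) * acoef N lam k l p' (i + 1) +
        acoef N lam l k p (i + 1) * acoef N lam l k p' (i + 1)) = if p = p' then 1 else 0 := by
  have hN : 1 ≤ N := by omega
  have hNpos : (0 : ℝ) < N := by positivity
  have hmem : ∀ q : ℕ, 0 < q → q < N →
      0 < q * Real.pi / N ∧ q * Real.pi / N < Real.pi := by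
    intro q h0 h1
    have h0' : (0 : ℝ) < q := by exact_mod_cast h0
    have h1' : (q : ℝ) < N := by exact_mod_cast h1
    refine ⟨by positivity, ?_⟩
    rw [div_lt_iff₀ hNpos]
    nlinarith [Real.pi_pos]
  have hsum := sum_sin_differences N (lam k) (lam l) (p * Real.pi / N) (p' * Real.pi / N)
    (sin_nat_mul_angle hN p)
  have hfactor : ∑ i ∈ Finset.range N,
      (acoef N lam k l p (i + 1) * acoef N lam k l p' (i + 1) +
        acoef N lam l k p (i + 1) * acoef N lam l k p' (i + 1)) =
      (Real.sqrt ((N : ℝ) * (lam k ^ 2 + lam l ^ 2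
        - 2 * lam k * lam l * Real.cos (p * Real.pi / N))))⁻¹ *
      (Real.sqrt ((N : ℝ) * (lam k ^ 2 + lam l ^ 2
        - 2 * lam k * lam l * Real.cos (p' * Real.pi / N))))⁻¹ *
      (2 * (lam k ^ 2 + lam l ^ 2 - 2 * lam k * lam l * Real.cos (p' * Real.pi / N)) *
        ∑ i ∈ Finset.range N, Real.sin (i * (p * Real.pi / N)) *
          Real.sin (i * (p' * Real.pi / N))) := by
    rw [← hsum, Finset.mul_sum]
    refine Finset.sum_congr rfl fun i _ => ?_
    simp only [acoef_succ]
    rw [add_comm (lam l ^ 2), mul_right_comm 2 (lam l)]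
    ring
  rw [hfactor]
  split_ifs with h
  · subst h
    rw [sum_sin_sq_eq N p _ (mul_div_cancel₀ _ hNpos.ne')
      (Real.sin_pos_of_pos_of_lt_pi (hmem p hp0 hpN).1 (hmem p hp0 hpN).2).ne']
    have hD := sq_add_sq_sub_cos_pos (θ := p * Real.pi / N) (hpos k) (hpos l) hkl
    set D := lam k ^ 2 + lam l ^ 2 - 2 * lam k * lam l * Real.cos (p * Real.pi / N)
    have hND : 0 < N * D := mul_pos hNpos hD
    rw [← mul_inv, Real.mul_self_sqrt hND.le]
    field_simp
  · rw [sum_sin_mul_sin_eq_zero N _ _ (sin_nat_mul_angle hN p) (sin_nat_mul_angle hN p'),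
      mul_zero, mul_zero]
    intro hcos
    have hang := Real.injOn_cos ⟨(hmem p hp0 hpN).1.le, (hmem p hp0 hpN).2.le⟩
      ⟨(hmem p' hp0' hpN').1.le, (hmem p' hp0' hpN').2.le⟩ hcos
    rw [div_left_inj' hNpos.ne', mul_left_inj' Real.pi_pos.ne'] at hang
    exact h (by exact_mod_cast hang)

theorem sum_geom_mul_acoef {d N : ℕ} (hN : 1 ≤ N) (lam : Fin d → ℝ) (k l : Fin d) (c : ℝ)
    (p : ℕ) :
    ∑ i ∈ Finset.range N,
      c * lam k ^ i * lam l ^ (N - (i + 1)) * acoef N lam l k p (i + 1) = 0 := by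
  have h := sum_geom_mul_difference_eq_zero N (lam k) (lam l)
    (fun i => Real.sin (i * (p * Real.pi / N))) (by simp) (sin_nat_mul_angle hN p)
  simp only [acoef_succ]
  push_cast at h
  rw [← mul_zero (c * (Real.sqrt ((N : ℝ) * (lam l ^ 2 + lam k ^ 2
        - 2 * lam l * lam k * Real.cos (p * Real.pi / N))))⁻¹), ← h, Finset.mul_sum]
  exact Finset.sum_congr rfl fun i _ => by ring

/-- The coefficient of `q_{s,k} q_{s-1,l}ᵀ` in the `s`-th component of `u^{k,l,p}`. -/
noncomputable def uvecCoefLeft {d : ℕ} (N : ℕ) (lam : Fin d → ℝ) (k l : Fin d) (p s : ℕ) : ℝ :=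
  if p = 0 then 0
  else if p = N then
    Real.sqrt ((lam k ^ 2 - lam l ^ 2) / (lam k ^ (2 * N) - lam l ^ (2 * N))) *
        lam k ^ (N - s) * lam l ^ (s - 1)
  else acoef N lam k l p s

/-- The coefficient of `q_{s,l} q_{s-1,k}ᵀ` in the `s`-th component of `u^{k,l,p}`. -/
noncomputable def uvecCoefRight {d : ℕ} (N : ℕ) (lam : Fin d → ℝ) (k l : Fin d) (p s : ℕ) : ℝ :=
  if p = 0 then
    Real.sqrt ((lam k ^ 2 - lam l ^ 2) / (lam k ^ (2 * N) - lam l ^ (2 * N))) *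
        lam k ^ (s - 1) * lam l ^ (N - s)
  else if p = N then 0
  else acoef N lam l k p s

theorem uvec_eq {d : ℕ} (N : ℕ) (Q : ℕ → Matrix (Fin d) (Fin d) ℝ)
    (lam : Fin d → ℝ) (k l : Fin d) (p s : ℕ) :
    uvec N Q lam k l p s =
      uvecCoefLeft N lam k l p s •
        Matrix.vecMulVec (fun i => Q s i k) (fun i => Q (s - 1) i l) +
      uvecCoefRight N lam k l p s •
        Matrix.vecMulVec (fun i => Q s i l) (fun i => Q (s - 1) i k) := by
  unfold uvec uvecCoefLeft uvecCoefRight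
  split_ifs <;> simp

theorem sum_uvecCoef {d N : ℕ} (hN : 1 ≤ N) (lam : Fin d → ℝ)
    (hpos : ∀ i, 0 < lam i) {k l : Fin d} (hkl : lam k ≠ lam l) {p p' : ℕ}
    (hp : p ≤ N) (hp' : p' ≤ N) :
    ∑ s ∈ Finset.Icc 1 N,
      (uvecCoefLeft N lam k l p s * uvecCoefLeft N lam k l p' s +
        uvecCoefRight N lam k l p s * uvecCoefRight N lam k l p' s) =
      if p = p' then 1 else 0 := by
  rw [sum_Icc_one_eq_sum_range]
  have hN0 : N ≠ 0 := by omega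
  have hzero := sum_geom_mul_acoef hN lam k l
    (Real.sqrt ((lam k ^ 2 - lam l ^ 2) / (lam k ^ (2 * N) - lam l ^ (2 * N))))
  have hlast := sum_geom_mul_acoef hN lam l k
    (Real.sqrt ((lam k ^ 2 - lam l ^ 2) / (lam k ^ (2 * N) - lam l ^ (2 * N))))
  simp only [mul_right_comm _ (lam l ^ _) (lam k ^ _)] at hlast
  have hgeom := sum_geom_sq N hN (hpos k) (hpos l) hkl
  have hgeom' := sum_geom_sq N hN (hpos l) (hpos k) hkl.symm
  rw [← neg_sub (lam k ^ 2), ← neg_sub (lam k ^ (2 * N)), neg_div_neg_eq] at hgeom'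
  simp only [mul_right_comm _ (lam l ^ _) (lam k ^ _)] at hgeom'
  rcases Nat.eq_zero_or_pos p with rfl | hp0
  · rcases Nat.eq_zero_or_pos p' with rfl | hp0'
    · simpa [uvecCoefLeft, uvecCoefRight] using hgeom
    · rcases hp'.eq_or_lt with rfl | hpN'
      · simp [uvecCoefLeft, uvecCoefRight, hN0, hN0.symm]
      · simpa [uvecCoefLeft, uvecCoefRight, hp0'.ne', hp0'.ne, hpN'.ne] using hzero p'
  · rcases hp.eq_or_lt with rfl | hpN
    · rcases Nat.eq_zero_or_pos p' with rfl | hp0'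
      · simp [uvecCoefLeft, uvecCoefRight, hN0]
      · rcases hp'.eq_or_lt with rfl | hpN'
        · simpa [uvecCoefLeft, uvecCoefRight, hN0] using hgeom'
        · simpa [uvecCoefLeft, uvecCoefRight, hN0, hp0'.ne', hpN'.ne, hpN'.ne'] using hlast p'
    · rcases Nat.eq_zero_or_pos p' with rfl | hp0'
      · simpa [uvecCoefLeft, uvecCoefRight, hp0.ne', hpN.ne, mul_comm (acoef _ _ _ _ _ _)]
          using hzero p
      · rcases hp'.eq_or_lt with rfl | hpN'
        · simpa [uvecCoefLeft, uvecCoefRight, hN0, hp0.ne', hpN.ne,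
            mul_comm (acoef _ _ _ _ _ _)] using hlast p
        · simpa [uvecCoefLeft, uvecCoefRight, hp0.ne', hpN.ne, hp0'.ne', hpN'.ne]
            using sum_acoef_mul_acoef lam hpos hkl hp0 hpN hp0' hpN'

theorem trace_transpose_vecMulVec_mul_vecMulVec {d : ℕ} (u v w z : Fin d → ℝ) :
    ((Matrix.vecMulVec u v)ᵀ * Matrix.vecMulVec w z).trace = (u ⬝ᵥ w) * (v ⬝ᵥ z) := by
  rw [Matrix.transpose_vecMulVec, Matrix.vecMulVec_mul_vecMulVec, Matrix.trace_vecMulVec,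
    dotProduct_smul, smul_eq_mul]

theorem dotProduct_columns {d : ℕ} {A : Matrix (Fin d) (Fin d) ℝ} (hA : Aᵀ * A = 1)
    (a b : Fin d) : (fun i => A i a) ⬝ᵥ (fun i => A i b) = if a = b then 1 else 0 := by
  have h := congrFun (congrFun hA a) b
  rwa [Matrix.mul_apply, Matrix.one_apply] at h

/-- The rank-one matrices built from the columns of two orthogonal matrices are orthonormal. -/
theorem trace_column_outer {d : ℕ} {A B : Matrix (Fin d) (Fin d) ℝ} (hA : Aᵀ * A = 1)
    (hB : Bᵀ * B = 1) (a b a' b' : Fin d) :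
    ((Matrix.vecMulVec (fun i => A i a) (fun i => B i b))ᵀ *
      Matrix.vecMulVec (fun i => A i a') (fun i => B i b')).trace =
      if a = a' ∧ b = b' then 1 else 0 := by
  rw [trace_transpose_vecMulVec_mul_vecMulVec, dotProduct_columns hA, dotProduct_columns hB]
  split_ifs <;> simp_all

/-- **orthonormal basis of the tangent space, Menon–Yu.**
For orthogonal `Q_0,…,Q_N` and distinct positive `λ_1,…,λ_d`, the family of the
`d` tuples `l^k` together with the `(N+1)d(d−1)/2` tuples `u^{k,l,p}`
(`1 ≤ k < l ≤ d`, `0 ≤ p ≤ N`) is orthonormal in `M_d^N` for the Frobenius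
inner product. -/
theorem dln_orthonormal_basis {d N : ℕ} (hN : 1 ≤ N)
    (Q : ℕ → Matrix (Fin d) (Fin d) ℝ) (hQ : ∀ p ≤ N, (Q p)ᵀ * Q p = 1)
    (lam : Fin d → ℝ) (hpos : ∀ i, 0 < lam i) (hinj : Function.Injective lam) :
    (∀ k k' : Fin d,
        tupInner N (lvec N Q k) (lvec N Q k') = if k = k' then 1 else 0)
    ∧ (∀ k k' l' : Fin d, k' < l' → ∀ p ≤ N,
        tupInner N (lvec N Q k) (uvec N Q lam k' l' p) = 0)
    ∧ (∀ k l k' l' : Fin d, k < l → k' < l' → ∀ p ≤ N, ∀ p' ≤ N,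
        tupInner N (uvec N Q lam k l p) (uvec N Q lam k' l' p')
          = if k = k' ∧ l = l' ∧ p = p' then 1 else 0) := by
  have hcol : ∀ s ∈ Finset.Icc 1 N, ∀ a b a' b' : Fin d,
      ((Matrix.vecMulVec (fun i => Q s i a) (fun i => Q (s - 1) i b))ᵀ *
        Matrix.vecMulVec (fun i => Q s i a') (fun i => Q (s - 1) i b')).trace =
        if a = a' ∧ b = b' then 1 else 0 := fun s hs =>
    have hs' := Finset.mem_Icc.1 hs
    trace_column_outer (hQ s hs'.2) (hQ (s - 1) (by omega))
  refine ⟨fun k k' => ?_, fun k k' l' hkl p _ => ?_, fun k l k' l' hkl hkl' p hp p' hp' => ?_⟩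
  · have hNpos : (0 : ℝ) < N := by positivity
    have hterm : ∀ s ∈ Finset.Icc 1 N, ((lvec N Q k s)ᵀ * lvec N Q k' s).trace =
        if k = k' then (N : ℝ)⁻¹ else 0 := by
      intro s hs
      unfold lvec
      rw [Matrix.transpose_smul, Matrix.smul_mul, Matrix.mul_smul, Matrix.trace_smul,
        Matrix.trace_smul, hcol s hs, smul_smul, ← mul_inv, Real.mul_self_sqrt hNpos.le]
      simp
    rw [tupInner, Finset.sum_congr rfl hterm]
    split_ifs <;> simp [hNpos.ne']
  · refine Finset.sum_eq_zero fun s hs => ?_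
    have h1 : ¬ (k = k' ∧ k = l') := fun h => hkl.ne (h.1.symm.trans h.2)
    have h2 : ¬ (k = l' ∧ k = k') := fun h => h1 h.symm
    unfold lvec
    rw [uvec_eq, Matrix.transpose_smul, Matrix.smul_mul, Matrix.mul_add, Matrix.mul_smul,
      Matrix.mul_smul, Matrix.trace_smul, Matrix.trace_add, Matrix.trace_smul, Matrix.trace_smul,
      hcol s hs, hcol s hs, if_neg h1, if_neg h2]
    simp
  · have hterm : ∀ s ∈ Finset.Icc 1 N,
        ((uvec N Q lam k l p s)ᵀ * uvec N Q lam k' l' p' s).trace =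
        if k = k' ∧ l = l' then
          uvecCoefLeft N lam k l p s * uvecCoefLeft N lam k' l' p' s +
            uvecCoefRight N lam k l p s * uvecCoefRight N lam k' l' p' s
        else 0 := by
      intro s hs
      have h1 : ¬ (k = l' ∧ l = k') := by
        rintro ⟨rfl, rfl⟩
        exact lt_asymm hkl hkl'
      have h2 : ¬ (l = k' ∧ k = l') := fun h => h1 h.symm
      simp only [uvec_eq, Matrix.transpose_add, Matrix.transpose_smul, Matrix.add_mul,
        Matrix.mul_add, Matrix.smul_mul, Matrix.mul_smul, Matrix.trace_add, Matrix.trace_smul,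
        hcol s hs, if_neg h1, if_neg h2, and_comm (a := l = l'), smul_eq_mul]
      split_ifs <;> ring
    rw [tupInner, Finset.sum_congr rfl hterm]
    by_cases h : k = k' ∧ l = l'
    · obtain ⟨rfl, rfl⟩ := h
      simpa using sum_uvecCoef hN lam hpos (hinj.ne hkl.ne) hp hp'
    · simp [← and_assoc, h]
end

section
/- (Rotational directions lie in the kernel of the differential of the end-to-end map.) Let Q_0,…,Q_N ∈ O(d) with q_{p,i} the i-th column of Q_p, let Λ = diag(λ_1,…,λ_d) with distinct positive entries, and set W_p = Q_p Λ Q_{p−1}ᵀ. For 1 ≤ k < l ≤ d and 1 ≤ p ≤ N−1 define u^{k,l,p} ∈ M_d^N with s-th component u_s^{k,l,p} = a^{k,l,p,s} q_{s,k} q_{s−1,l}ᵀ + a^{l,k,p,s} q_{s,l} q_{s−1,k}ᵀ, where a^{k,l,p,s} = [N(λ_k² + λ_l² − 2λ_kλ_l cos(pπ/N))]^{−1/2} (λ_k sin((s−1)pπ/N) − λ_l sin(spπ/N)). Then ∑_{s=1}^N (W_N⋯W_{s+1}) u_s^{k,l,p} (W_{s−1}⋯W_1) = 0 for every 1 ≤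 p ≤ N−1 and 1 ≤ k < l ≤ d, i.e. these tangent tuples lie in the kernel of the differential of the map 𝐖 ↦ W_N⋯W_1. -/
open Matrix BigOperators

attribute [local instance] Matrix.normedAddCommGroup Matrix.normedSpace

/-- The interior (rotational) tuples `u^{k,l,p}`, `1 ≤ p ≤ N−1`, of Menon–Yu:
`u_s^{k,l,p} = a^{k,l,p,s} q_{s,k} q_{s−1,l}ᵀ + a^{l,k,p,s} q_{s,l} q_{s−1,k}ᵀ`. -/
noncomputable def uvecInt {d : ℕ} (N : ℕ) (Q : ℕ → Matrix (Fin d) (Fin d) ℝ)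
    (lam : Fin d → ℝ) (k l : Fin d) (p s : ℕ) : Matrix (Fin d) (Fin d) ℝ :=
  acoef N lam k l p s • Matrix.vecMulVec (fun i => Q s i k) (fun i => Q (s - 1) i l)
  + acoef N lam l k p s • Matrix.vecMulVec (fun i => Q s i l) (fun i => Q (s - 1) i k)

/-- A product of `j` consecutive factors `Q_m Λ Q_{m-1}ᵀ` telescopes when the `Q_m` are orthogonal. -/
theorem prod_map_range_orthogonal_conj {d N : ℕ} (Q : ℕ → Matrix (Fin d) (Fin d) ℝ)
    (hQ : ∀ p ≤ N, (Q p)ᵀ * Q p = 1) (lam : Fin d → ℝ) {n : ℕ} (hn : n ≤ N) (j : ℕ) (hj : j ≤ n) :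
    ((List.range j).map
      (fun i => Q (n - i) * Matrix.diagonal lam * (Q (n - i - 1))ᵀ)).prod
      = Q n * Matrix.diagonal lam ^ j * (Q (n - j))ᵀ := by
  induction j with
  | zero => simp [mul_eq_one_comm.mp (hQ n hn)]
  | succ j ih =>
    rw [List.range_succ, List.map_append, List.prod_append, ih (by omega)]
    simp only [List.map_cons, List.map_nil, List.prod_cons, List.prod_nil, mul_one]
    rw [Nat.sub_sub, pow_succ]
    calc Q n * Matrix.diagonal lam ^ j * (Q (n - j))ᵀ *
          (Q (n - j) * Matrix.diagonal lam * (Q (n - (j + 1)))ᵀ)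
        = Q n * Matrix.diagonal lam ^ j * ((Q (n - j))ᵀ * Q (n - j)) *
          Matrix.diagonal lam * (Q (n - (j + 1)))ᵀ := by simp only [mul_assoc]
      _ = _ := by rw [hQ (n - j) (by omega)]; simp only [mul_one, mul_assoc]

/-- Multiplying `q_k r_lᵀ` by powers of `Λ` in the frames `Q` and `R` only rescales it. -/
theorem mul_vecMulVec_col_mul {d : ℕ} (P Q R S : Matrix (Fin d) (Fin d) ℝ)
    (hQ : Qᵀ * Q = 1) (hR : Rᵀ * R = 1) (lam : Fin d → ℝ) (k l : Fin d) (m n : ℕ) :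
    P * Matrix.diagonal lam ^ m * Qᵀ * Matrix.vecMulVec (fun i => Q i k) (fun i => R i l) *
        (R * Matrix.diagonal lam ^ n * S)
      = (lam k ^ m * lam l ^ n) • (P * Matrix.single k l 1 * S) := by
  have h : Matrix.vecMulVec (fun i => Q i k) (fun i => R i l)
      = Q * Matrix.single k l (1 : ℝ) * Rᵀ := by
    rw [Matrix.single_eq_single_vecMulVec_single, Matrix.mul_vecMulVec, Matrix.vecMulVec_mul]
    congr 1 <;> ext i <;> simp
  have hs : Matrix.diagonal lam ^ m * Matrix.single k l (1 : ℝ) * Matrix.diagonal lam ^ n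
      = (lam k ^ m * lam l ^ n) • Matrix.single k l (1 : ℝ) := by
    ext i j
    rw [Matrix.diagonal_pow, Matrix.diagonal_pow, Matrix.mul_diagonal, Matrix.diagonal_mul]
    by_cases hi : k = i <;> by_cases hj : l = j <;> simp [hi, hj]
  calc _ = P * Matrix.diagonal lam ^ m * (Qᵀ * Q) * Matrix.single k l 1 * (Rᵀ * R) *
          Matrix.diagonal lam ^ n * S := by rw [h]; simp only [mul_assoc]
    _ = P * (Matrix.diagonal lam ^ m * Matrix.single k l 1 * Matrix.diagonal lam ^ n) * S := by
        rw [hQ, hR]; simp only [mul_one, mul_assoc]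
    _ = _ := by rw [hs, Matrix.mul_smul, Matrix.smul_mul]

theorem sum_acoef_mul_pow_eq_zero {d N : ℕ} (hN : 1 ≤ N) (lam : Fin d → ℝ) (k l : Fin d) (p : ℕ) :
    ∑ t ∈ Finset.range N,
      acoef N lam k l p (t + 1) * (lam k ^ (N - (t + 1)) * lam l ^ t) = 0 := by
  have hN' : (N : ℝ) ≠ 0 := by positivity
  let f : ℕ → ℝ := fun t =>
    lam k ^ (N - t) * lam l ^ t * Real.sin ((t : ℝ) * p * Real.pi / N)
  have hf : ∑ t ∈ Finset.range N, (f t - f (t + 1)) = 0 := by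
    have hend : (N : ℝ) * p * Real.pi / N = p * Real.pi := by field_simp
    rw [Finset.sum_range_sub']
    simp [f, hend, Real.sin_nat_mul_pi]
  rw [← mul_zero (Real.sqrt ((N : ℝ) * (lam k ^ 2 + lam l ^ 2
      - 2 * lam k * lam l * Real.cos (p * Real.pi / N))))⁻¹, ← hf, Finset.mul_sum]
  refine Finset.sum_congr rfl fun t ht => ?_
  have hpow : lam k ^ (N - t) = lam k ^ (N - (t + 1)) * lam k := by
    rw [← pow_succ]
    congr 1
    have := Finset.mem_range.mp ht
    omega
  simp only [acoef, f, hpow]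
  push_cast
  rw [add_sub_cancel_right]
  ring

/-- **rotational directions lie in the kernel of `dφ`.**
With `W_p = Q_p Λ Q_{p−1}ᵀ`, for `1 ≤ p ≤ N−1` and `k < l`,
`∑_{s=1}^N (W_N⋯W_{s+1}) u_s^{k,l,p} (W_{s−1}⋯W_1) = 0`: the interior tuples
`u^{k,l,p}` lie in the kernel of the differential of `𝐖 ↦ W_N⋯W_1`. -/
theorem dln_vertical_kernel {d N : ℕ} (hN : 1 ≤ N)
    (Q : ℕ → Matrix (Fin d) (Fin d) ℝ) (hQ : ∀ p ≤ N, (Q p)ᵀ * Q p = 1)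
    (lam : Fin d → ℝ) (hpos : ∀ i, 0 < lam i) (hinj : Function.Injective lam) :
    ∀ k l : Fin d, k < l → ∀ p, 1 ≤ p → p < N →
      ∑ s ∈ Finset.Icc 1 N,
        Aprod (fun q => Q q * Matrix.diagonal lam * (Q (q - 1))ᵀ) N (s + 1) *
          uvecInt N Q lam k l p s *
          Bprod (fun q => Q q * Matrix.diagonal lam * (Q (q - 1))ᵀ) (s - 1) = 0 := by
  intro k l _ p _ _
  have hterm : ∀ t ∈ Finset.range N,
      Aprod (fun q => Q q * Matrix.diagonal lam * (Q (q - 1))ᵀ) N (t + 1 + 1) *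
          uvecInt N Q lam k l p (t + 1) *
          Bprod (fun q => Q q * Matrix.diagonal lam * (Q (q - 1))ᵀ) (t + 1 - 1)
        = (acoef N lam k l p (t + 1) * (lam k ^ (N - (t + 1)) * lam l ^ t)) •
            (Q N * Matrix.single k l 1 * (Q 0)ᵀ)
          + (acoef N lam l k p (t + 1) * (lam l ^ (N - (t + 1)) * lam k ^ t)) •
            (Q N * Matrix.single l k 1 * (Q 0)ᵀ) := by
    intro t ht
    have ht : t + 1 ≤ N := Finset.mem_range.mp ht
    have hA := prod_map_range_orthogonal_conj Q hQ lam le_rfl (N - (t + 1)) (by omega)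
    have hB := prod_map_range_orthogonal_conj Q hQ lam (show t ≤ N by omega) t le_rfl
    rw [Nat.sub_sub_self ht] at hA
    rw [Nat.sub_self] at hB
    have hlen : N + 1 - (t + 1 + 1) = N - (t + 1) := by omega
    simp only [Aprod, Bprod, uvecInt, hlen, Nat.add_sub_cancel, hA, hB]
    rw [mul_add, add_mul, Matrix.mul_smul, Matrix.mul_smul, Matrix.smul_mul, Matrix.smul_mul,
      mul_vecMulVec_col_mul _ _ _ _ (hQ _ ht) (hQ _ (by omega)),
      mul_vecMulVec_col_mul _ _ _ _ (hQ _ ht) (hQ _ (by omega)), smul_smul, smul_smul]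
  rw [← Finset.Ico_add_one_right_eq_Icc, Finset.sum_Ico_eq_sum_range, Nat.add_sub_cancel]
  simp only [Nat.add_comm 1]
  rw [Finset.sum_congr rfl hterm, Finset.sum_add_distrib, ← Finset.sum_smul, ← Finset.sum_smul,
    sum_acoef_mul_pow_eq_zero hN, sum_acoef_mul_pow_eq_zero hN, zero_smul, zero_smul, add_zero]
end
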